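/- Let n ≥ 1, let f : ℝⁿ → ℝ be smooth, fix x₀ ∈ ℝⁿ, R ≥ 2, K ≥ 0, t₀ ∈ ℝ, T > 0, a ≥ 0 and D > 0. Assume ⟨Hess f(x) v, v⟩ ≥ −(n−1)K|v|² for all x in the ball B(x₀,R) and all v ∈ ℝⁿ, and let u be a smooth function on Q_{R,T} = B(x₀,R) × [t₀−T,t₀] with 0 < u ≤ D solving the nonlinear f-heat equation ∂u/∂t = Δ_f u + a·u·ln u. Then there exists a constant c depending only on n such that for all (x,t) ∈ B(x₀,R/2) × (t₀−T, t₀], |∇u|(x,t)/u(x,t) ≤ c·( √((1+|α|)/R) + 1/√(t−t₀+T) + √K + √(a(κ+1)) )·( 1 + ln(D/u(x,t)) ), where κ = max{|ln D|, 1} and α = max_{|x−x₀|=1} ( (n−1) − ⟨∇f(x), x−x₀⟩ ). (This is the Euclidean-space case of the paper's Theorem 1.4(i), Souplet-Zhang-type gradient estimate.) -/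

import Mathlib

open Metric Set
open scoped RealInnerProductSpace

noncomputable section

/-- Euclidean Laplacian on `EuclideanSpace ℝ (Fin n)`. -/
def eLap {n : ℕ} (u : EuclideanSpace ℝ (Fin n) → ℝ) (x : EuclideanSpace ℝ (Fin n)) : ℝ :=
  ∑ i : Fin n,
    fderiv ℝ (fun y => fderiv ℝ u y (EuclideanSpace.single i 1)) x (EuclideanSpace.single i 1)

/-- Weighted (drift) Laplacian `Δ_f u = Δu − ⟨∇f, ∇u⟩`. -/
def fLap {n : ℕ} (f u : EuclideanSpace ℝ (Fin n) → ℝ) (x : EuclideanSpace ℝ (Fin n)) : ℝ :=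
  eLap u x - ⟪gradient f x, gradient u x⟫

/-- Hessian quadratic form of `f` at `x` evaluated at `(v, v)`. -/
def hessQF {n : ℕ} (f : EuclideanSpace ℝ (Fin n) → ℝ) (x v : EuclideanSpace ℝ (Fin n)) : ℝ :=
  fderiv ℝ (fun y => fderiv ℝ f y v) x v

/-- The constant `α = max_{|x−x₀|=1} ((n−1) − ⟨∇f(x), x−x₀⟩)`. -/
def alphaC {n : ℕ} (f : EuclideanSpace ℝ (Fin n) → ℝ) (x₀ : EuclideanSpace ℝ (Fin n)) : ℝ :=
  sSup ((fun y => (n : ℝ) - 1 - ⟪gradient f y, y - x₀⟫) '' sphere x₀ 1)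

section calculus

variable {X : Type*} [NormedAddCommGroup X] [NormedSpace ℝ X]

/-- Smoothness on a set. -/
def Sm (O : Set X) (g : X → ℝ) : Prop := ContDiffOn ℝ (⊤ : ℕ∞) g O

/-- Directional derivative. -/
def dd (V : X) (g : X → ℝ) : X → ℝ := fun p => fderiv ℝ g p V

variable {O : Set X} {g h : X → ℝ} {p : X}

theorem Sm.cda (hg : Sm O g) (hO : IsOpen O) (hp : p ∈ O) : ContDiffAt ℝ (⊤ : ℕ∞) g p :=
  ContDiffOn.contDiffAt hg (hO.mem_nhds hp)

theorem Sm.da (hg : Sm O g) (hO : IsOpen O) (hp : p ∈ O) : DifferentiableAt ℝ g p :=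
  (hg.cda hO hp).differentiableAt (by simp)

theorem Sm.dd (hg : Sm O g) (hO : IsOpen O) (V : X) : Sm O (dd V g) := by
  have : ContDiffOn ℝ (⊤ : ℕ∞) (fderiv ℝ g) O := ContDiffOn.fderiv_of_isOpen hg hO (by simp)
  exact this.clm_apply contDiffOn_const

theorem dd_congr (hO : IsOpen O) (hp : p ∈ O) (H : ∀ q ∈ O, g q = h q) (V : X) :
    dd V g p = dd V h p := by
  have : g =ᶠ[nhds p] h := by
    filter_upwards [hO.mem_nhds hp] with q hq using H q hq
  simp only [dd]
  rw [this.fderiv_eq]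

theorem dd_comm (hg : Sm O g) (hO : IsOpen O) (hp : p ∈ O) (V W : X) :
    dd V (dd W g) p = dd W (dd V g) p := by
  have h1 : IsSymmSndFDerivAt ℝ g p := (hg.cda hO hp).isSymmSndFDerivAt (by
    simp only [minSmoothness_of_isRCLikeNormedField]
    exact WithTop.coe_le_coe.2 (le_top : (2 : ℕ∞) ≤ ⊤))
  have h2 : ContDiffOn ℝ (⊤ : ℕ∞) (fderiv ℝ g) O := ContDiffOn.fderiv_of_isOpen hg hO (by simp)
  have h3 : DifferentiableAt ℝ (fderiv ℝ g) p :=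
    (h2.contDiffAt (hO.mem_nhds hp)).differentiableAt (by simp)
  have key : ∀ A B : X, dd A (dd B g) p = fderiv ℝ (fderiv ℝ g) p A B := by
    intro A B
    have : HasFDerivAt (fun q => fderiv ℝ g q B) _ p :=
      h3.hasFDerivAt.clm_apply (hasFDerivAt_const B p)
    change fderiv ℝ (fun q => fderiv ℝ g q B) p A = _
    rw [this.fderiv]
    simp
  rw [key, key]
  exact h1 V W

theorem dd_mul (hg : DifferentiableAt ℝ g p) (hh : DifferentiableAt ℝ h p) (V : X) :
    dd V (fun q => g q * h q) p = dd V g p * h p + g p * dd V h p := by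
  simp only [dd]
  rw [fderiv_fun_mul hg hh]
  simp
  ring

theorem dd_add (hg : DifferentiableAt ℝ g p) (hh : DifferentiableAt ℝ h p) (V : X) :
    dd V (fun q => g q + h q) p = dd V g p + dd V h p := by
  simp only [dd]
  rw [fderiv_fun_add hg hh]
  simp

theorem dd_sub (hg : DifferentiableAt ℝ g p) (hh : DifferentiableAt ℝ h p) (V : X) :
    dd V (fun q => g q - h q) p = dd V g p - dd V h p := by
  simp only [dd]
  rw [fderiv_fun_sub hg hh]
  simp

theorem dd_const (c : ℝ) (V : X) : dd V (fun _ => c) p = 0 := by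
  simp [dd]

theorem dd_sum {ι : Type*} (s : Finset ι) {G : ι → X → ℝ}
    (hG : ∀ i ∈ s, DifferentiableAt ℝ (G i) p) (V : X) :
    dd V (fun q => ∑ i ∈ s, G i q) p = ∑ i ∈ s, dd V (G i) p := by
  simp only [dd]
  rw [fderiv_fun_sum hG]
  simp

theorem dd_comp {P : ℝ → ℝ} {P' : ℝ} (hP : HasDerivAt P P' (g p)) (hg : DifferentiableAt ℝ g p)
    (V : X) : dd V (fun q => P (g q)) p = P' * dd V g p := by
  simp only [dd]
  have := hP.comp_hasFDerivAt p hg.hasFDerivAt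
  have e : (fun q => P (g q)) = P ∘ g := rfl
  rw [e, this.fderiv]
  simp

/-- derivative along a line -/
theorem dd_line (hg : DifferentiableAt ℝ g p) (V : X) (q : X) (s : ℝ) (hs : q + s • V = p) :
    HasDerivAt (fun r : ℝ => g (q + r • V)) (dd V g p) s := by
  subst hs
  have h1 : HasDerivAt (fun r : ℝ => q + r • V) V s := by
    simpa using ((hasDerivAt_id s).smul_const V).const_add q
  exact hg.hasFDerivAt.comp_hasDerivAt s h1

/-- First- and second-order conditions at an interior local max along a line. -/
theorem dd_max (hg : Sm O g) (hO : IsOpen O) (hp : p ∈ O) (V : X)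
    (hmax : ∀ᶠ s : ℝ in nhds 0, g (p + s • V) ≤ g p) :
    dd V g p = 0 ∧ dd V (dd V g) p ≤ 0 := by
  set k : ℝ → ℝ := fun r => g (p + r • V) with hk
  have hloc : IsLocalMax k 0 := by
    filter_upwards [hmax] with s hs
    simpa [hk] using hs
  have hcont : Filter.Tendsto (fun r : ℝ => p + r • V) (nhds 0) (nhds p) := by
    have : Continuous (fun r : ℝ => p + r • V) := by fun_prop
    simpa using this.tendsto 0
  have hin : ∀ᶠ s : ℝ in nhds 0, p + s • V ∈ O := hcont (hO.mem_nhds hp)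
  have hd : ∀ᶠ s : ℝ in nhds 0, deriv k s = dd V g (p + s • V) := by
    filter_upwards [hin] with s hs
    exact (dd_line (hg.da hO hs) V p s rfl).deriv
  have hd0 : deriv k 0 = dd V g p := by simpa using hd.self_of_nhds
  have h0 : deriv k 0 = 0 := hloc.deriv_eq_zero
  have hdd : deriv (deriv k) 0 = dd V (dd V g) p := by
    rw [Filter.EventuallyEq.deriv_eq hd]
    exact (dd_line ((hg.dd hO V).da hO hp) V p 0 (by simp)).deriv
  refine ⟨by rw [← hd0, h0], ?_⟩
  by_contra hcon
  push Not at hcon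
  rw [← hdd] at hcon
  have hc : ContinuousAt k 0 :=
    (dd_line (hg.da hO hp) V p 0 (by simp)).continuousAt
  have hmin := isLocalMin_of_deriv_deriv_pos hcon h0 hc
  have heq : k =ᶠ[nhds 0] fun _ => k 0 := by
    filter_upwards [hloc, hmin] with s h1 h2
    exact le_antisymm h1 h2
  have : deriv k =ᶠ[nhds 0] fun _ => 0 := by
    have := heq.deriv
    simpa using this
  have := this.deriv_eq
  simp at this
  linarith

theorem dd_left_max (hg : DifferentiableAt ℝ g p) (V : X) {ε : ℝ} (hε : 0 < ε)
    (hmax : ∀ s : ℝ, -ε < s → s ≤ 0 → g (p + s • V) ≤ g p) : 0 ≤ dd V g p := by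
  have h := dd_line hg V p 0 (by simp)
  have h2 := hasDerivWithinAt_iff_tendsto_slope.1 (h.hasDerivWithinAt (s := Iio 0))
  have hs : (Iio (0:ℝ)) \ {0} = Iio 0 := by
    ext x; simp only [mem_sdiff, mem_Iio, mem_singleton_iff]
    exact ⟨fun h => h.1, fun h => ⟨h, h.ne⟩⟩
  rw [hs] at h2
  refine ge_of_tendsto h2 ?_
  filter_upwards [Ioo_mem_nhdsLT (show -ε < 0 by linarith)] with s hs
  have := hmax s hs.1 hs.2.le
  rw [slope_def_field]
  apply div_nonneg_of_nonpos
  · simpa using this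
  · linarith [hs.2]

end calculus
section bochner

theorem bochner_algebra {ι : Type*} [Fintype ι] (A Fj W : ι → ℝ) (H T FF : ι → ι → ℝ)
    (E w aL B : ℝ) (hH : ∀ i j, H i j = H j i) (hw : w = ∑ i, A i * A i)
    (hW : ∀ j, W j = ∑ i, (H j i * A i + A i * H j i))
    (hB : -B * w ≤ ∑ i, ∑ j, FF i j * A i * A j) :
    2 * E * w ^ 2 + 2 * (E - 1) * (∑ j, A j * W j) - 2 * B * w - 2 * aL * w ≤
    (∑ j, ∑ i, ((T i j * A i + H j i * H j i) + (H j i * H j i + A i * T i j)))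
      - (∑ j, Fj j * W j)
      - ∑ i, ((∑ j, T i j - ∑ j, (FF i j * A j + Fj j * H i j)
          + (-(E * A i) * w + (1 - E) * W i) + aL * A i) * A i +
        A i * (∑ j, T i j - ∑ j, (FF i j * A j + Fj j * H i j)
          + (-(E * A i) * w + (1 - E) * W i) + aL * A i)) := by
  have h1 : (∑ j, ∑ i, ((T i j * A i + H j i * H j i) + (H j i * H j i + A i * T i j)))
      = 2 * (∑ j, ∑ i, H j i ^ 2) + 2 * ∑ i, ∑ j, A i * T i j := by
    rw [Finset.sum_comm (f := fun i j => A i * T i j), Finset.mul_sum, Finset.mul_sum,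
      ← Finset.sum_add_distrib]
    refine Finset.sum_congr rfl fun j _ => ?_
    rw [Finset.mul_sum, Finset.mul_sum, ← Finset.sum_add_distrib]
    exact Finset.sum_congr rfl fun i _ => by ring
  have h2 : (∑ j, Fj j * W j) = 2 * ∑ i, ∑ j, A i * (Fj j * H i j) := by
    rw [Finset.sum_comm, Finset.mul_sum]
    refine Finset.sum_congr rfl fun j _ => ?_
    rw [hW, Finset.mul_sum, Finset.mul_sum]
    exact Finset.sum_congr rfl fun i _ => by rw [hH i j]; ring
  have h3 : ∑ i, ((∑ j, T i j - ∑ j, (FF i j * A j + Fj j * H i j)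
          + (-(E * A i) * w + (1 - E) * W i) + aL * A i) * A i +
        A i * (∑ j, T i j - ∑ j, (FF i j * A j + Fj j * H i j)
          + (-(E * A i) * w + (1 - E) * W i) + aL * A i)) =
      2 * (∑ i, ∑ j, A i * T i j) - 2 * (∑ i, ∑ j, FF i j * A i * A j)
       - 2 * (∑ i, ∑ j, A i * (Fj j * H i j)) - 2 * E * w * (∑ i, A i * A i)
       + 2 * (1 - E) * (∑ j, A j * W j) + 2 * aL * (∑ i, A i * A i) := by
    simp only [Finset.mul_sum, ← Finset.sum_add_distrib, ← Finset.sum_sub_distrib]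
    refine Finset.sum_congr rfl fun i _ => ?_
    have e1 : ∑ j, 2 * (A i * T i j) = 2 * A i * ∑ j, T i j := by
      rw [Finset.mul_sum]; exact Finset.sum_congr rfl fun j _ => by ring
    have e2 : ∑ j, 2 * (FF i j * A i * A j) = 2 * A i * ∑ j, FF i j * A j := by
      rw [Finset.mul_sum]; exact Finset.sum_congr rfl fun j _ => by ring
    have e3 : ∑ j, 2 * (A i * (Fj j * H i j)) = 2 * A i * ∑ j, Fj j * H i j := by
      rw [Finset.mul_sum]; exact Finset.sum_congr rfl fun j _ => by ring
    rw [Finset.sum_sub_distrib, Finset.sum_sub_distrib, Finset.sum_sub_distrib,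
      Finset.sum_add_distrib, e1, e2, e3]
    ring
  have h4 : 0 ≤ ∑ j, ∑ i, H j i ^ 2 :=
    Finset.sum_nonneg fun j _ => Finset.sum_nonneg fun i _ => sq_nonneg _
  rw [← hw] at h3
  rw [h1, h2, h3]
  nlinarith

variable {X : Type*} [NormedAddCommGroup X] [NormedSpace ℝ X]
variable {O : Set X} {F φ : X → ℝ} {p : X} {ι : Type*} [Fintype ι]

/-- squared length of the gradient along the frame `e`. -/
def gsq (e : ι → X) (φ : X → ℝ) : X → ℝ := fun q => ∑ i, dd (e i) φ q * dd (e i) φ q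

theorem Sm.mul {g h : X → ℝ} (hg : Sm O g) (hh : Sm O h) : Sm O (fun q => g q * h q) :=
  ContDiffOn.mul hg hh

theorem Sm.sum {G : ι → X → ℝ} (hG : ∀ i, Sm O (G i)) : Sm O (fun q => ∑ i, G i q) :=
  ContDiffOn.sum fun i _ => hG i

theorem Sm.gsq (hO : IsOpen O) (hφ : Sm O φ) (e : ι → X) : Sm O (gsq e φ) :=
  Sm.sum fun i => (hφ.dd hO (e i)).mul (hφ.dd hO (e i))

theorem dd_gsq (hO : IsOpen O) (hφ : Sm O φ) (e : ι → X) (hp : p ∈ O) (V : X) :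
    dd V (gsq e φ) p = ∑ i, (dd V (dd (e i) φ) p * dd (e i) φ p
      + dd (e i) φ p * dd V (dd (e i) φ) p) := by
  unfold gsq
  rw [dd_sum]
  · refine Finset.sum_congr rfl fun i _ => ?_
    exact dd_mul ((hφ.dd hO (e i)).da hO hp) ((hφ.dd hO (e i)).da hO hp) V
  · intro i _
    exact ((hφ.dd hO (e i)).mul (hφ.dd hO (e i))).da hO hp

theorem dd_dd_gsq (hO : IsOpen O) (hφ : Sm O φ) (e : ι → X) (hp : p ∈ O) (V : X) :
    dd V (dd V (gsq e φ)) p = ∑ i, ((dd (e i) (dd V (dd V φ)) p * dd (e i) φ p +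
       dd V (dd (e i) φ) p * dd V (dd (e i) φ) p) +
      (dd V (dd (e i) φ) p * dd V (dd (e i) φ) p
      + dd (e i) φ p * dd (e i) (dd V (dd V φ)) p)) := by
  rw [dd_congr hO hp (fun q hq => dd_gsq hO hφ e hq V) V]
  have s1 : ∀ i, Sm O (dd (e i) φ) := fun i => hφ.dd hO (e i)
  have s2 : ∀ i, Sm O (dd V (dd (e i) φ)) := fun i => (s1 i).dd hO V
  have hc : ∀ i, dd V (dd V (dd (e i) φ)) p = dd (e i) (dd V (dd V φ)) p := by
    intro i
    rw [dd_congr hO hp (fun q hq => dd_comm hφ hO hq V (e i)) V]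
    exact dd_comm (hφ.dd hO V) hO hp V (e i)
  rw [dd_sum]
  · refine Finset.sum_congr rfl fun i _ => ?_
    rw [dd_add (((s2 i).mul (s1 i)).da hO hp) (((s1 i).mul (s2 i)).da hO hp),
      dd_mul ((s2 i).da hO hp) ((s1 i).da hO hp), dd_mul ((s1 i).da hO hp) ((s2 i).da hO hp), hc]
  · intro i _
    exact (((s2 i).mul (s1 i)).da hO hp).add (((s1 i).mul (s2 i)).da hO hp)

theorem bochner (hO : IsOpen O) (hF : Sm O F) (hφ : Sm O φ) (e : ι → X) (τ : X) (a L B : ℝ)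
    (hp : p ∈ O)
    (heq : ∀ q ∈ O, dd τ φ q = ∑ j, dd (e j) (dd (e j) φ) q - ∑ j, dd (e j) F q * dd (e j) φ q
      + (1 - Real.exp (φ q)) * gsq e φ q + (a - a * L * Real.exp (-φ q)))
    (hB : -B * gsq e φ p ≤
      ∑ i, ∑ j, dd (e i) (dd (e j) F) p * dd (e i) φ p * dd (e j) φ p) :
    2 * Real.exp (φ p) * gsq e φ p ^ 2
      + 2 * (Real.exp (φ p) - 1) * (∑ j, dd (e j) φ p * dd (e j) (gsq e φ) p)
      - 2 * B * gsq e φ p - 2 * (a * L * Real.exp (-φ p)) * gsq e φ p ≤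
    ∑ j, dd (e j) (dd (e j) (gsq e φ)) p - ∑ j, dd (e j) F p * dd (e j) (gsq e φ) p
      - dd τ (gsq e φ) p := by
  have s1 : ∀ V, Sm O (dd V φ) := fun V => hφ.dd hO V
  have s2 : ∀ V W, Sm O (dd V (dd W φ)) := fun V W => (s1 W).dd hO V
  have f1 : ∀ V, Sm O (dd V F) := fun V => hF.dd hO V
  have hw : Sm O (gsq e φ) := Sm.gsq hO hφ e
  have ht : ∀ i, dd τ (dd (e i) φ) p = ∑ j, dd (e i) (dd (e j) (dd (e j) φ)) p
      - ∑ j, (dd (e i) (dd (e j) F) p * dd (e j) φ p + dd (e j) F p * dd (e i) (dd (e j) φ) p)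
      + (-(Real.exp (φ p) * dd (e i) φ p) * gsq e φ p
        + (1 - Real.exp (φ p)) * dd (e i) (gsq e φ) p)
      + (a * L * Real.exp (-φ p)) * dd (e i) φ p := by
    intro i
    rw [dd_comm hφ hO hp, dd_congr hO hp heq (e i)]
    have dφ := hφ.da hO hp
    have d1 : DifferentiableAt ℝ (fun q => ∑ j, dd (e j) (dd (e j) φ) q) p :=
      (Sm.sum fun j => s2 (e j) (e j)).da hO hp
    have d2 : DifferentiableAt ℝ (fun q => ∑ j, dd (e j) F q * dd (e j) φ q) p :=
      (Sm.sum fun j => (f1 (e j)).mul (s1 (e j))).da hO hp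
    have d3 : DifferentiableAt ℝ (fun q => 1 - Real.exp (φ q)) p := dφ.exp.const_sub 1
    have d4 : DifferentiableAt ℝ (fun q => a - a * L * Real.exp (-φ q)) p :=
      (dφ.neg.exp.const_mul (a * L)).const_sub a
    have dw := hw.da hO hp
    rw [dd_add ((d1.fun_sub d2).fun_add (d3.fun_mul dw)) d4, dd_add (d1.fun_sub d2) (d3.fun_mul dw), dd_sub d1 d2,
      dd_mul d3 dw]
    have c1 : dd (e i) (fun q => 1 - Real.exp (φ q)) p = -(Real.exp (φ p) * dd (e i) φ p) := by
      rw [dd_comp (P := fun y => 1 - Real.exp y) ((Real.hasDerivAt_exp (φ p)).const_sub 1) dφ]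
      ring
    have c2 : dd (e i) (fun q => a - a * L * Real.exp (-φ q)) p
        = (a * L * Real.exp (-φ p)) * dd (e i) φ p := by
      have hh : HasDerivAt (fun y => a - a * L * Real.exp (-y))
          (-(a * L * (Real.exp (-φ p) * (-1)))) (φ p) :=
        (((hasDerivAt_id (φ p)).neg.exp).const_mul (a * L)).const_sub a
      rw [dd_comp hh dφ]
      ring
    rw [c1, c2, dd_sum _ (fun j _ => (s2 (e j) (e j)).da hO hp),
      dd_sum _ (fun j _ => ((f1 (e j)).mul (s1 (e j))).da hO hp)]
    congr 3
    congr 1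
    exact funext fun j => dd_mul ((f1 (e j)).da hO hp) ((s1 (e j)).da hO hp) _
  have e1 : ∑ j, dd (e j) (dd (e j) (gsq e φ)) p = _ :=
    Finset.sum_congr rfl fun j _ => dd_dd_gsq hO hφ e hp (e j)
  rw [e1, dd_gsq hO hφ e hp τ]
  simp only [ht]
  exact bochner_algebra (fun i => dd (e i) φ p) (fun j => dd (e j) F p)
    (fun j => dd (e j) (gsq e φ) p) (fun i j => dd (e i) (dd (e j) φ) p)
    (fun i j => dd (e i) (dd (e j) (dd (e j) φ)) p) (fun i j => dd (e i) (dd (e j) F) p)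
    _ _ _ B (fun i j => dd_comm hφ hO hp _ _) rfl (fun j => dd_gsq hO hφ e hp (e j)) hB

end bochner
section maxprinciple

theorem max_algebra {ι : Type*} [Fintype ι] (A W P Fj wd pd : ι → ℝ)
    (w ψ ψt wt E B C₁ C₂ C₃ : ℝ) (hwpos : 0 < w) (hψ : 0 < ψ) (hE : 1 ≤ E) (hB : 0 ≤ B)
    (hC₁ : 0 ≤ C₁) (hC₂ : 0 ≤ C₂) (hC₃ : 0 ≤ C₃)
    (hw : w = ∑ i, A i * A i)
    (h1 : ∀ i, P i * w + ψ * W i = 0)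
    (h2 : ∀ i, pd i * w + 2 * (P i * W i) + ψ * wd i ≤ 0)
    (h3 : 0 ≤ ψt * w + ψ * wt)
    (hb : 2 * E * w ^ 2 + 2 * (E - 1) * (∑ j, A j * W j) - 2 * B * w ≤
      ∑ j, wd j - ∑ j, Fj j * W j - wt)
    (hP : ∑ i, P i * P i ≤ C₁ * ψ)
    (hL : -(∑ i, pd i - ∑ i, Fj i * P i) ≤ C₂) (hψt : ψt ≤ C₃) :
    ψ * w ≤ 3 * C₁ + 2 * B * ψ + C₂ + C₃ := by
  have a1 : ψ * (∑ j, A j * W j) = -w * ∑ j, A j * P j := by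
    rw [Finset.mul_sum, Finset.mul_sum]
    exact Finset.sum_congr rfl fun j _ => by linear_combination A j * h1 j
  have a2 : ψ * (∑ j, Fj j * W j) = -w * ∑ j, Fj j * P j := by
    rw [Finset.mul_sum, Finset.mul_sum]
    exact Finset.sum_congr rfl fun j _ => by linear_combination Fj j * h1 j
  have a3 : ψ * (∑ j, P j * W j) = -w * ∑ j, P j * P j := by
    rw [Finset.mul_sum, Finset.mul_sum]
    exact Finset.sum_congr rfl fun j _ => by linear_combination P j * h1 j
  have a4 : (∑ i, pd i) * w + 2 * (∑ i, P i * W i) + ψ * ∑ i, wd i ≤ 0 := by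
    have := Finset.sum_nonpos (s := Finset.univ) fun i _ => h2 i
    rw [Finset.sum_add_distrib, Finset.sum_add_distrib, ← Finset.sum_mul, ← Finset.mul_sum,
      ← Finset.mul_sum] at this
    exact this
  have a5 : (∑ j, A j * P j) ^ 2 ≤ w * ∑ j, P j * P j := by
    rw [hw]
    have := Finset.sum_mul_sq_le_sq_mul_sq Finset.univ A P
    simpa [sq] using this
  set Q := ∑ j, A j * P j
  set S := ∑ j, A j * W j
  set FP := ∑ j, Fj j * P j
  set FW := ∑ j, Fj j * W j
  set PW := ∑ j, P j * W j
  set PP := ∑ j, P j * P j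
  set Pd := ∑ i, pd i
  set Wd := ∑ i, wd i
  have b1 : -w * C₁ ≤ PW := by
    have : ψ * (-w * C₁) ≤ ψ * PW := by rw [a3]; nlinarith
    exact le_of_mul_le_mul_left this hψ
  have b2 : 2 * Q ≤ ψ * w + C₁ := by
    have h5 : Q ^ 2 ≤ w * (C₁ * ψ) := a5.trans (by gcongr)
    have h6 : (2 * Q) ^ 2 ≤ (ψ * w + C₁) ^ 2 := by nlinarith [sq_nonneg (ψ * w - C₁)]
    exact le_of_sq_le_sq h6 (by positivity)
  have b3 : ψ * (2 * E * w ^ 2 + 2 * (E - 1) * S - 2 * B * w) ≤ ψ * (Wd - FW - wt) := by gcongr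
  have b4 : w * (2 * E * (ψ * w) - 2 * (E - 1) * Q - 2 * B * ψ) ≤
      w * (C₂ + 2 * C₁ + C₃) := by
    have : w * (-(Pd - FP)) ≤ w * C₂ := by gcongr
    have : ψt * w ≤ C₃ * w := by gcongr
    have e : ψ * (2 * E * w ^ 2 + 2 * (E - 1) * S - 2 * B * w) =
       w * (2 * E * (ψ * w) - 2 * (E - 1) * Q - 2 * B * ψ) := by
      linear_combination 2 * (E - 1) * a1
    rw [e] at b3
    nlinarith
  have b5 := le_of_mul_le_mul_left b4 hwpos
  have b6 : (E - 1) * (2 * Q) ≤ (E - 1) * (ψ * w + C₁) := by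
    have : 0 ≤ E - 1 := by linarith
    gcongr
  have b7 : 0 < ψ * w := by positivity
  have b8 : E * (ψ * w) ≤ E * (3 * C₁ + 2 * B * ψ + C₂ + C₃) := by
    have : 0 ≤ 2 * B * ψ + C₂ + C₃ + 2 * C₁ := by positivity
    nlinarith
  exact le_of_mul_le_mul_left b8 (by linarith)

variable {n : ℕ}

/-- spatial frame in space-time. -/
def sp (n : ℕ) (i : Fin n) : EuclideanSpace ℝ (Fin n) × ℝ := (EuclideanSpace.single i 1, 0)

/-- time direction in space-time. -/
def tm (n : ℕ) : EuclideanSpace ℝ (Fin n) × ℝ := (0, 1)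

theorem dd_snd (V p : EuclideanSpace ℝ (Fin n) × ℝ) (s₀ : ℝ) :
    dd V (fun q : EuclideanSpace ℝ (Fin n) × ℝ => q.2 - s₀) p = V.2 := by
  have : HasFDerivAt (fun q : EuclideanSpace ℝ (Fin n) × ℝ => q.2 - s₀)
    (ContinuousLinearMap.snd ℝ _ _) p := (hasFDerivAt_snd).sub_const s₀
  simp only [dd]
  rw [this.fderiv]
  simp

theorem dd_fst (V p : EuclideanSpace ℝ (Fin n) × ℝ) (g : EuclideanSpace ℝ (Fin n) → ℝ)
    (hg : DifferentiableAt ℝ g p.1) :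
    dd V (fun q : EuclideanSpace ℝ (Fin n) × ℝ => g q.1) p = dd V.1 g p.1 := by
  have : HasFDerivAt (fun q : EuclideanSpace ℝ (Fin n) × ℝ => g q.1)
    ((fderiv ℝ g p.1).comp (ContinuousLinearMap.fst ℝ _ _)) p :=
    hg.hasFDerivAt.comp p hasFDerivAt_fst
  simp only [dd]
  rw [this.fderiv]
  simp

theorem max_principle {O : Set (EuclideanSpace ℝ (Fin n) × ℝ)} (hO : IsOpen O)
    {F φ : EuclideanSpace ℝ (Fin n) × ℝ → ℝ} {η : EuclideanSpace ℝ (Fin n) → ℝ}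
    (hφ : Sm O φ) (hη : ContDiff ℝ (⊤ : ℕ∞) η)
    (x₀ : EuclideanSpace ℝ (Fin n)) (ρ s₀ t : ℝ) (hst : s₀ < t)
    (hsub : closedBall x₀ ρ ×ˢ Icc s₀ t ⊆ O)
    (hη0 : ∀ x, 0 ≤ η x) (hη1 : ∀ x, η x ≤ 1) (hηs : ∀ x, 0 < η x → x ∈ ball x₀ ρ)
    (B c₁ c₂ : ℝ) (hB : 0 ≤ B) (hc₁ : 0 ≤ c₁) (hc₂ : 0 ≤ c₂)
    (hφ0 : ∀ p ∈ O, 0 ≤ φ p)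
    (hb : ∀ p ∈ O, 2 * Real.exp (φ p) * gsq (sp n) φ p ^ 2
      + 2 * (Real.exp (φ p) - 1) * (∑ j, dd (sp n j) φ p * dd (sp n j) (gsq (sp n) φ) p)
      - 2 * B * gsq (sp n) φ p ≤
      ∑ j, dd (sp n j) (dd (sp n j) (gsq (sp n) φ)) p
      - ∑ j, dd (sp n j) F p * dd (sp n j) (gsq (sp n) φ) p - dd (tm n) (gsq (sp n) φ) p)
    (h1 : ∀ x ∈ ball x₀ ρ, ∑ i, dd (EuclideanSpace.single i 1) η x *
      dd (EuclideanSpace.single i 1) η x ≤ c₁ * η x)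
    (h2 : ∀ p ∈ O, p.1 ∈ ball x₀ ρ →
      -(∑ i, dd (EuclideanSpace.single i 1) (dd (EuclideanSpace.single i 1) η) p.1
       - ∑ i, dd (sp n i) F p * dd (EuclideanSpace.single i 1) η p.1) ≤ c₂)
    (x : EuclideanSpace ℝ (Fin n)) (hx : x ∈ closedBall x₀ ρ) :
    η x * gsq (sp n) φ (x, t) ≤ 3 * c₁ + 2 * B + c₂ + 1 / (t - s₀) := by
  set w := gsq (sp n) φ with hwdef
  have hw : Sm O w := Sm.gsq hO hφ _
  set ψ : EuclideanSpace ℝ (Fin n) × ℝ → ℝ := fun p => (p.2 - s₀) * η p.1 with hψdef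
  have hN : Sm O (fun p : EuclideanSpace ℝ (Fin n) × ℝ => η p.1) :=
    (hη.comp contDiff_fst).contDiffOn
  have hT : Sm O (fun p : EuclideanSpace ℝ (Fin n) × ℝ => p.2 - s₀) :=
    (contDiff_snd.sub contDiff_const).contDiffOn
  have hψ : Sm O ψ := hT.mul hN
  have hG : Sm O (fun p => ψ p * w p) := hψ.mul hw
  have hKc : IsCompact (closedBall x₀ ρ ×ˢ Icc s₀ t) :=
    (isCompact_closedBall x₀ ρ).prod isCompact_Icc
  have hxt : (x, t) ∈ closedBall x₀ ρ ×ˢ Icc s₀ t := ⟨hx, hst.le, le_rfl⟩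
  obtain ⟨p, hpK, hpmax⟩ := hKc.exists_isMaxOn ⟨_, hxt⟩ (hG.continuousOn.mono hsub)
  have hmx : ∀ q ∈ closedBall x₀ ρ ×ˢ Icc s₀ t, ψ q * w q ≤ ψ p * w p := fun q hq => hpmax hq
  have hp : p ∈ O := hsub hpK
  have hts : 0 < t - s₀ := by linarith
  have hfin : (t - s₀) * (η x * w (x, t)) ≤ ψ p * w p := by
    have := hmx _ hxt
    simp only [hψdef] at this ⊢
    linarith
  have hwnn : 0 ≤ w p := Finset.sum_nonneg fun i _ => mul_self_nonneg _
  suffices hkey : ψ p * w p ≤ (t - s₀) * (3 * c₁ + 2 * B + c₂) + 1 by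
    have : (t - s₀) * (η x * w (x, t)) ≤ (t - s₀) * (3 * c₁ + 2 * B + c₂ + 1 / (t - s₀)) := by
      refine (hfin.trans hkey).trans (le_of_eq ?_)
      field_simp
    exact le_of_mul_le_mul_left this hts
  rcases le_or_gt (ψ p * w p) 0 with hneg | hpos
  · exact hneg.trans (by positivity)
  have hψnn : 0 ≤ ψ p := mul_nonneg (by linarith [hpK.2.1]) (hη0 _)
  have hψpos : 0 < ψ p := by
    rcases hψnn.lt_or_eq with h | h
    · exact h
    · rw [← h] at hpos; simp at hpos
  have hwpos : 0 < w p := by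
    rcases hwnn.lt_or_eq with h | h
    · exact h
    · rw [← h] at hpos; simp at hpos
  have hτ : 0 < p.2 - s₀ := by
    rcases (sub_nonneg.2 hpK.2.1).lt_or_eq with h | h
    · exact h
    · simp only [hψdef, ← h] at hψpos; simp at hψpos
  have hηpos : 0 < η p.1 := by
    rcases (hη0 p.1).lt_or_eq with h | h
    · exact h
    · simp only [hψdef, ← h] at hψpos; simp at hψpos
  have hpb := hηs _ hηpos
  have dN : ∀ q, DifferentiableAt ℝ η q := fun q => hη.differentiable (by simp) q
  have ηS : Sm univ η := hη.contDiffOn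
  have dη : ∀ V q, DifferentiableAt ℝ (dd V η) q := fun V q =>
    (ηS.dd isOpen_univ V).da isOpen_univ (mem_univ q)
  -- derivatives of the cutoff
  have psi1 : ∀ i, ∀ q ∈ O, dd (sp n i) ψ q =
      (q.2 - s₀) * dd (EuclideanSpace.single i 1) η q.1 := by
    intro i q hq
    simp only [hψdef]
    rw [dd_mul (hT.da hO hq) (hN.da hO hq), dd_snd, dd_fst _ _ _ (dN _)]
    simp [sp]
  have psi2 : ∀ i, dd (sp n i) (dd (sp n i) ψ) p =
      (p.2 - s₀) * dd (EuclideanSpace.single i 1) (dd (EuclideanSpace.single i 1) η) p.1 := by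
    intro i
    rw [dd_congr hO hp (psi1 i)]
    have hd : DifferentiableAt ℝ (fun q : EuclideanSpace ℝ (Fin n) × ℝ =>
        dd (EuclideanSpace.single i 1) η q.1) p :=
      DifferentiableAt.comp p (dη _ _) differentiableAt_fst
    rw [dd_mul (hT.da hO hp) hd, dd_snd, dd_fst _ _ _ (dη _ _)]
    simp [sp]
  have psit : dd (tm n) ψ p = η p.1 := by
    simp only [hψdef]
    rw [dd_mul (hT.da hO hp) (hN.da hO hp), dd_snd, dd_fst _ _ _ (dN _)]
    simp [tm, dd]
  -- max conditions
  have hspace : ∀ i, dd (sp n i) (fun q => ψ q * w q) p = 0 ∧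
      dd (sp n i) (dd (sp n i) (fun q => ψ q * w q)) p ≤ 0 := by
    intro i
    refine dd_max hG hO hp _ ?_
    have hc : Filter.Tendsto (fun s : ℝ => p.1 + s • EuclideanSpace.single i (1 : ℝ)) (nhds 0)
        (nhds p.1) := by
      have : Continuous (fun s : ℝ => p.1 + s • EuclideanSpace.single i (1 : ℝ)) := by fun_prop
      simpa using this.tendsto 0
    filter_upwards [hc (isOpen_ball.mem_nhds hpb)] with s hs
    refine hmx _ ⟨ball_subset_closedBall ?_, ?_⟩
    · simpa [sp] using hs
    · simpa [sp] using hpK.2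
  have htime : 0 ≤ dd (tm n) (fun q => ψ q * w q) p := by
    refine dd_left_max (hG.da hO hp) _ hτ ?_
    intro s hs1 hs2
    refine hmx _ ⟨?_, ?_⟩
    · simpa [tm] using hpK.1
    · have := hpK.2.2
      simp only [tm, Prod.snd_add, Prod.smul_snd, smul_eq_mul, mul_one, mem_Icc]
      constructor <;> linarith
  have g1 : ∀ i, ∀ q ∈ O, dd (sp n i) (fun q => ψ q * w q) q =
      dd (sp n i) ψ q * w q + ψ q * dd (sp n i) w q := fun i q hq =>
    dd_mul (hψ.da hO hq) (hw.da hO hq) _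
  have g2 : ∀ i, dd (sp n i) (dd (sp n i) (fun q => ψ q * w q)) p =
      dd (sp n i) (dd (sp n i) ψ) p * w p + 2 * (dd (sp n i) ψ p * dd (sp n i) w p)
        + ψ p * dd (sp n i) (dd (sp n i) w) p := by
    intro i
    rw [dd_congr hO hp (g1 i), dd_add
      (((hψ.dd hO (sp n i)).mul hw).da hO hp) ((hψ.mul (hw.dd hO (sp n i))).da hO hp),
      dd_mul ((hψ.dd hO (sp n i)).da hO hp) (hw.da hO hp),
      dd_mul (hψ.da hO hp) ((hw.dd hO (sp n i)).da hO hp)]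
    ring
  have hη1p := hη1 p.1
  have hle : ψ p ≤ t - s₀ := by
    have := hpK.2.2
    simp only [hψdef]
    nlinarith
  have hple : p.2 - s₀ ≤ t - s₀ := by linarith [hpK.2.2]
  have hres := max_algebra (fun i => dd (sp n i) φ p) (fun i => dd (sp n i) w p)
    (fun i => dd (sp n i) ψ p) (fun i => dd (sp n i) F p)
    (fun i => dd (sp n i) (dd (sp n i) w) p) (fun i => dd (sp n i) (dd (sp n i) ψ) p)
    (w p) (ψ p) (dd (tm n) ψ p) (dd (tm n) w p) (Real.exp (φ p)) B ((p.2 - s₀) * c₁)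
    ((p.2 - s₀) * c₂) 1 hwpos hψpos (Real.one_le_exp (hφ0 p hp)) hB (by positivity)
    (by positivity) zero_le_one rfl
    (fun i => by rw [← g1 i p hp]; exact (hspace i).1)
    (fun i => by rw [← g2 i]; exact (hspace i).2)
    (by rw [← dd_mul (hψ.da hO hp) (hw.da hO hp)]; exact htime)
    (hb p hp)
    (by
      simp only [psi1 _ p hp]
      have : ∑ i, (p.2 - s₀) * dd (EuclideanSpace.single i 1) η p.1 *
        ((p.2 - s₀) * dd (EuclideanSpace.single i 1) η p.1) =
        (p.2 - s₀) ^ 2 * ∑ i, dd (EuclideanSpace.single i 1) η p.1 *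
          dd (EuclideanSpace.single i 1) η p.1 := by
        rw [Finset.mul_sum]
        exact Finset.sum_congr rfl fun i _ => by ring
      rw [this]
      calc _ ≤ (p.2 - s₀) ^ 2 * (c₁ * η p.1) := by gcongr; exact h1 _ hpb
        _ = _ := by simp only [hψdef]; ring)
    (by
      simp only [psi1 _ p hp, psi2]
      have : ∑ i, dd (sp n i) F p * ((p.2 - s₀) * dd (EuclideanSpace.single i 1) η p.1) =
        (p.2 - s₀) * ∑ i, dd (sp n i) F p * dd (EuclideanSpace.single i 1) η p.1 := by
        rw [Finset.mul_sum]
        exact Finset.sum_congr rfl fun i _ => by ring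
      rw [this, ← Finset.mul_sum, ← mul_sub, ← mul_neg]
      gcongr
      exact h2 p hp hpb)
    (by rw [psit]; exact hη1p)
  calc ψ p * w p ≤ _ := hres
    _ ≤ 3 * ((t - s₀) * c₁) + 2 * B * (t - s₀) + (t - s₀) * c₂ + 1 := by gcongr
    _ = _ := by ring

end maxprinciple
section cutoff

variable {n : ℕ}

theorem euclid_expand (v : EuclideanSpace ℝ (Fin n)) :
    v = ∑ i, v i • EuclideanSpace.single i (1 : ℝ) := by
  ext j
  simp [Finset.sum_apply, Pi.single_apply]

theorem dd_expand (f : EuclideanSpace ℝ (Fin n) → ℝ) (x v : EuclideanSpace ℝ (Fin n)) :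
    dd v f x = ∑ i, v i * dd (EuclideanSpace.single i 1) f x := by
  simp only [dd]
  conv_lhs => rw [euclid_expand v]
  rw [map_sum]
  simp

theorem gradient_inner (f : EuclideanSpace ℝ (Fin n) → ℝ) (x v : EuclideanSpace ℝ (Fin n)) :
    ⟪gradient f x, v⟫ = dd v f x := by
  simp [gradient, dd]

theorem gradient_inner_sum (f g : EuclideanSpace ℝ (Fin n) → ℝ) (x : EuclideanSpace ℝ (Fin n)) :
    ⟪gradient f x, gradient g x⟫ =
      ∑ i, dd (EuclideanSpace.single i 1) f x * dd (EuclideanSpace.single i 1) g x := by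
  rw [gradient_inner, dd_expand]
  refine Finset.sum_congr rfl fun i _ => ?_
  rw [← gradient_inner g, EuclideanSpace.inner_single_right]
  simp [mul_comm]

theorem alpha_compare (hn : 1 ≤ n) {f : EuclideanSpace ℝ (Fin n) → ℝ}
    (hf : ContDiff ℝ (⊤ : ℕ∞) f) {x₀ x : EuclideanSpace ℝ (Fin n)} {R K : ℝ} (hK : 0 ≤ K)
    (hH : ∀ x ∈ ball x₀ R, ∀ v : EuclideanSpace ℝ (Fin n),
          hessQF f x v ≥ -((n : ℝ) - 1) * K * ‖v‖ ^ 2)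
    (hx : x ∈ ball x₀ R) (h1 : 1 ≤ ‖x - x₀‖) :
    (n : ℝ) - dd (x - x₀) f x ≤ 1 + R * |alphaC f x₀| + n * K * R ^ 2 := by
  have hn' : (1 : ℝ) ≤ n := by exact_mod_cast hn
  set r := ‖x - x₀‖ with hr
  have hr0 : 0 < r := by linarith
  have hrR : r < R := by simpa [mem_ball, dist_eq_norm] using hx
  set θ : EuclideanSpace ℝ (Fin n) := r⁻¹ • (x - x₀) with hθ
  have hθ1 : ‖θ‖ = 1 := by
    rw [hθ, norm_smul, ← hr, norm_inv, Real.norm_of_nonneg hr0.le]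
    field_simp
  have hrθ : r • θ = x - x₀ := by
    rw [hθ, smul_smul, mul_inv_cancel₀ hr0.ne', one_smul]
  have fS : Sm univ f := hf.contDiffOn
  have fS1 : Sm univ (dd θ f) := fS.dd isOpen_univ θ
  have hg : ∀ s : ℝ, HasDerivAt (fun s : ℝ => dd θ f (x₀ + s • θ))
      (dd θ (dd θ f) (x₀ + s • θ)) s := fun s =>
    dd_line (fS1.da isOpen_univ (mem_univ _)) θ x₀ s rfl
  have hmv := (convex_Icc (1 : ℝ) r).mul_sub_le_image_sub_of_le_deriv
    (f := fun s : ℝ => dd θ f (x₀ + s • θ))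
    (fun s _ => (hg s).continuousAt.continuousWithinAt)
    (fun s _ => (hg s).differentiableAt.differentiableWithinAt) (C := -((n : ℝ) - 1) * K)
    (by
      intro s hs
      rw [interior_Icc] at hs
      rw [(hg s).deriv]
      have := hH (x₀ + s • θ) (by
        rw [mem_ball, dist_eq_norm, add_sub_cancel_left, norm_smul, hθ1, mul_one,
          Real.norm_of_nonneg (by linarith [hs.1])]
        linarith [hs.2]) θ
      rw [hθ1, one_pow, mul_one] at this
      exact this)
    1 ⟨le_rfl, h1⟩ r ⟨h1, le_rfl⟩ h1
  simp only [one_smul, hrθ, add_sub_cancel] at hmv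
  have hα : (n : ℝ) - 1 - dd θ f (x₀ + θ) ≤ alphaC f x₀ := by
    have hgc : Continuous (gradient f) := by
      have : Continuous (fderiv ℝ f) := hf.continuous_fderiv (by simp)
      exact (InnerProductSpace.toDual ℝ _).symm.continuous.comp this
    have hbdd : BddAbove ((fun y => (n : ℝ) - 1 - ⟪gradient f y, y - x₀⟫) '' sphere x₀ 1) := by
      refine ((isCompact_sphere x₀ 1).image ?_).bddAbove
      fun_prop
    refine le_csSup hbdd ⟨x₀ + θ, ?_, ?_⟩
    · simp [hθ1]
    · simp only [add_sub_cancel_left, gradient_inner]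
  have hlin : dd (x - x₀) f x = r * dd θ f x := by
    rw [← hrθ]; simp [dd]
  rw [hlin]
  have habs := le_abs_self (alphaC f x₀)
  have habs0 := abs_nonneg (alphaC f x₀)
  have h5 : (n : ℝ) - 1 - |alphaC f x₀| - (n - 1) * K * (r - 1) ≤ dd θ f x := by
    linarith
  have h6 := mul_le_mul_of_nonneg_left h5 hr0.le
  have h7 : r * |alphaC f x₀| ≤ R * |alphaC f x₀| := by gcongr
  have h8 : r * ((n - 1) * K * (r - 1)) ≤ n * K * R ^ 2 := by
    have : ((n : ℝ) - 1) * K ≤ n * K := by nlinarith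
    have h9 : r * (r - 1) ≤ R ^ 2 := by nlinarith
    have h10 : 0 ≤ r * (r - 1) := by nlinarith
    calc r * ((n - 1) * K * (r - 1)) = ((n - 1) * K) * (r * (r - 1)) := by ring
      _ ≤ (n * K) * R ^ 2 := by gcongr
  nlinarith

theorem profile_exists : ∃ (P : ℝ → ℝ) (M : ℝ), 0 ≤ M ∧ ContDiff ℝ (⊤ : ℕ∞) P ∧
    (∀ y, 0 ≤ P y) ∧ (∀ y, P y ≤ 1) ∧ (∀ y, 1 ≤ y → P y = 1) ∧ (∀ y, 0 < P y → 0 < y) ∧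
    (∀ y, 0 ≤ deriv P y) ∧ (∀ y, 1 ≤ y → deriv P y = 0) ∧
    (∀ y ∈ Icc (0 : ℝ) 2, deriv P y ^ 2 ≤ M * P y) ∧
    (∀ y ∈ Icc (0 : ℝ) 2, deriv P y ≤ M) ∧
    (∀ y ∈ Icc (0 : ℝ) 2, |deriv (deriv P) y| ≤ M) := by
  set S := Real.smoothTransition
  have hS : ContDiff ℝ (⊤ : ℕ∞) S := Real.smoothTransition.contDiff
  have hP : ContDiff ℝ (⊤ : ℕ∞) (fun y => S y ^ 2) := hS.pow 2
  have hP1 : ContDiff ℝ (⊤ : ℕ∞) (deriv (fun y => S y ^ 2)) := by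
    exact (contDiff_infty_iff_deriv.1 hP).2
  have hS1 : Continuous (deriv S) := (contDiff_infty_iff_deriv.1 hS).2.continuous
  have hP2 : Continuous (deriv (deriv (fun y => S y ^ 2))) :=
    (contDiff_infty_iff_deriv.1 hP1).2.continuous
  obtain ⟨m1, hm1⟩ := (isCompact_Icc (a := (0 : ℝ)) (b := 2)).exists_bound_of_continuousOn
    hS1.continuousOn
  obtain ⟨m2, hm2⟩ := (isCompact_Icc (a := (0 : ℝ)) (b := 2)).exists_bound_of_continuousOn
    hP1.continuous.continuousOn
  obtain ⟨m3, hm3⟩ := (isCompact_Icc (a := (0 : ℝ)) (b := 2)).exists_bound_of_continuousOn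
    hP2.continuousOn
  have h0 : ∀ y, 0 ≤ S y := Real.smoothTransition.nonneg
  have hle : ∀ y, S y ≤ 1 := Real.smoothTransition.le_one
  refine ⟨fun y => S y ^ 2, 4 * m1 ^ 2 + |m2| + |m3|, by positivity, hP, fun y => by positivity,
    fun y => pow_le_one₀ (h0 y) (hle y), ?_, ?_, ?_, ?_, ?_, ?_, ?_⟩
  · intro y hy
    simp [S, Real.smoothTransition.one_of_one_le hy]
  · intro y hy
    by_contra hc
    push Not at hc
    simp [S, Real.smoothTransition.zero_of_nonpos hc] at hy
  · intro y
    have : Monotone (fun y => S y ^ 2) := fun a b hab =>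
      pow_le_pow_left₀ (h0 a) (Real.smoothTransition.monotone hab) 2
    exact this.deriv_nonneg
  · intro y hy
    apply IsLocalMax.deriv_eq_zero
    refine Filter.Eventually.of_forall fun z => ?_
    have : S y = 1 := Real.smoothTransition.one_of_one_le hy
    simp only [this, one_pow]
    exact pow_le_one₀ (h0 z) (hle z)
  · intro y hy
    have hd : HasDerivAt (fun y => S y ^ 2) (2 * S y * deriv S y) y := by
      have := ((hS.differentiable (by simp)) y).hasDerivAt.pow 2
      have h' : HasDerivAt (fun y => S y ^ 2) _ y := this
      convert h' using 1
      simp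
    rw [hd.deriv]
    have h1 := hm1 y hy
    have h2 : deriv S y ^ 2 ≤ m1 ^ 2 := by
      rw [← sq_abs]; exact pow_le_pow_left₀ (abs_nonneg _) h1 2
    have h3 := mul_le_mul_of_nonneg_left h2 (sq_nonneg (S y))
    have : 0 ≤ (|m2| + |m3|) * S y ^ 2 := by positivity
    nlinarith
  · intro y hy
    have := (le_abs_self _).trans (hm2 y hy)
    have := le_abs_self m2
    have := abs_nonneg m3
    have := sq_nonneg m1
    linarith
  · intro y hy
    have := hm3 y hy
    rw [Real.norm_eq_abs] at this
    have := le_abs_self m3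
    have := abs_nonneg m2
    have := sq_nonneg m1
    linarith

/-- The quadratic argument of the cutoff. -/
def qf (x₀ : EuclideanSpace ℝ (Fin n)) (R : ℝ) (x : EuclideanSpace ℝ (Fin n)) : ℝ :=
  (9 - 16 * ‖x - x₀‖ ^ 2 / R ^ 2) / 5

theorem qf_smooth (x₀ : EuclideanSpace ℝ (Fin n)) (R : ℝ) : ContDiff ℝ (⊤ : ℕ∞) (qf x₀ R) := by
  unfold qf
  have : ContDiff ℝ (⊤ : ℕ∞) (fun x : EuclideanSpace ℝ (Fin n) => ‖x - x₀‖ ^ 2) :=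
    (contDiff_id.sub contDiff_const).norm_sq ℝ
  fun_prop

theorem dd_qf (x₀ : EuclideanSpace ℝ (Fin n)) (R : ℝ) (i : Fin n) (x : EuclideanSpace ℝ (Fin n)) :
    dd (EuclideanSpace.single i 1) (qf x₀ R) x = -(32 / (5 * R ^ 2)) * (x i - x₀ i) := by
  have h1 : HasFDerivAt (fun x : EuclideanSpace ℝ (Fin n) => ‖x - x₀‖ ^ 2) _ x :=
    ((hasFDerivAt_id x).sub_const x₀).norm_sq
  have h2 := dd_comp (P := fun y => (9 - 16 * y / R ^ 2) / 5) (P' := (-(16 / R ^ 2)) / 5)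
    (g := fun x : EuclideanSpace ℝ (Fin n) => ‖x - x₀‖ ^ 2) (p := x)
    (by
      have := ((((hasDerivAt_id (‖x - x₀‖ ^ 2)).const_mul 16).div_const (R ^ 2)).const_sub 9).div_const 5
      simpa using this) h1.differentiableAt (EuclideanSpace.single i 1)
  unfold qf
  rw [h2]
  have h3 : dd (EuclideanSpace.single i 1) (fun x : EuclideanSpace ℝ (Fin n) => ‖x - x₀‖ ^ 2) x
      = 2 * (x i - x₀ i) := by
    simp only [dd]
    rw [h1.fderiv]
    simp [EuclideanSpace.inner_single_right]
  rw [h3]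
  by_cases hR : R = 0
  · simp [hR]
  · field_simp
    ring

theorem dd_dd_qf (x₀ : EuclideanSpace ℝ (Fin n)) (R : ℝ) (i : Fin n)
    (x : EuclideanSpace ℝ (Fin n)) :
    dd (EuclideanSpace.single i 1) (dd (EuclideanSpace.single i 1) (qf x₀ R)) x
      = -(32 / (5 * R ^ 2)) := by
  have : dd (EuclideanSpace.single i 1) (qf x₀ R) = fun x => -(32 / (5 * R ^ 2)) * (x i - x₀ i) :=
    funext fun y => dd_qf x₀ R i y
  rw [this]
  have h : HasFDerivAt (fun x : EuclideanSpace ℝ (Fin n) => -(32 / (5 * R ^ 2)) * (x i - x₀ i))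
      (-(32 / (5 * R ^ 2)) • (EuclideanSpace.proj i : EuclideanSpace ℝ (Fin n) →L[ℝ] ℝ)) x :=
    (((EuclideanSpace.proj i : EuclideanSpace ℝ (Fin n) →L[ℝ] ℝ).hasFDerivAt).sub_const
      (x₀ i)).const_mul _
  simp only [dd]
  rw [h.fderiv]
  simp

theorem cutoff_exists : ∃ M : ℝ, 0 ≤ M ∧ ∀ (n : ℕ) (_ : 1 ≤ n) (f : EuclideanSpace ℝ (Fin n) → ℝ)
    (_ : ContDiff ℝ (⊤ : ℕ∞) f) (x₀ : EuclideanSpace ℝ (Fin n)) (R K : ℝ) (_ : 0 ≤ K) (_ : 2 ≤ R)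
    (_ : ∀ x ∈ ball x₀ R, ∀ v : EuclideanSpace ℝ (Fin n),
          hessQF f x v ≥ -((n : ℝ) - 1) * K * ‖v‖ ^ 2),
    ∃ η : EuclideanSpace ℝ (Fin n) → ℝ, ContDiff ℝ (⊤ : ℕ∞) η ∧ (∀ x, 0 ≤ η x) ∧ (∀ x, η x ≤ 1) ∧
      (∀ x, 0 < η x → x ∈ ball x₀ (3 * R / 4)) ∧ (∀ x ∈ ball x₀ (R / 2), η x = 1) ∧
      (∀ x ∈ ball x₀ (3 * R / 4), ∑ i, dd (EuclideanSpace.single i 1) η x *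
        dd (EuclideanSpace.single i 1) η x ≤ M * ((1 + |alphaC f x₀|) / R) * η x) ∧
      (∀ x ∈ ball x₀ (3 * R / 4),
        -(∑ i, dd (EuclideanSpace.single i 1) (dd (EuclideanSpace.single i 1) η) x
       - ∑ i, dd (EuclideanSpace.single i 1) f x * dd (EuclideanSpace.single i 1) η x) ≤
        M * ((1 + |alphaC f x₀|) / R + n * K)) := by
  obtain ⟨P, M, hM, hP, P0, P1, Pone, Ppos, dP0, dPz, dPsq, dPM, ddPM⟩ := profile_exists
  refine ⟨32 * M, by positivity, ?_⟩
  intro n hn f hf x₀ R K hK hR hH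
  have hn' : (1 : ℝ) ≤ n := by exact_mod_cast hn
  have hR0 : 0 < R := by linarith
  have hq := qf_smooth x₀ R
  have hα0 := abs_nonneg (alphaC f x₀)
  have dP : ∀ y, HasDerivAt P (deriv P y) y := fun y =>
    (hP.differentiable (by simp) y).hasDerivAt
  have hP1 : ContDiff ℝ (⊤ : ℕ∞) (deriv P) := (contDiff_infty_iff_deriv.1 hP).2
  have ddP : ∀ y, HasDerivAt (deriv P) (deriv (deriv P) y) y := fun y =>
    (hP1.differentiable (by simp) y).hasDerivAt
  have dq : ∀ x, DifferentiableAt ℝ (qf x₀ R) x := fun x => hq.differentiable (by simp) x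
  have dη : ∀ i x, dd (EuclideanSpace.single i 1) (fun x => P (qf x₀ R x)) x =
      deriv P (qf x₀ R x) * dd (EuclideanSpace.single i 1) (qf x₀ R) x := fun i x =>
    dd_comp (dP _) (dq x) _
  have ddη : ∀ i x, dd (EuclideanSpace.single i 1) (dd (EuclideanSpace.single i 1)
      (fun x => P (qf x₀ R x))) x = deriv (deriv P) (qf x₀ R x) *
        dd (EuclideanSpace.single i 1) (qf x₀ R) x * dd (EuclideanSpace.single i 1) (qf x₀ R) x
        + deriv P (qf x₀ R x) * (-(32 / (5 * R ^ 2))) := by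
    intro i x
    have : dd (EuclideanSpace.single i 1) (fun x => P (qf x₀ R x)) = fun x =>
      deriv P (qf x₀ R x) * dd (EuclideanSpace.single i 1) (qf x₀ R) x := funext fun x => dη i x
    rw [this]
    have qS : Sm univ (qf x₀ R) := hq.contDiffOn
    rw [dd_mul (g := fun x => deriv P (qf x₀ R x))
      ((ddP (qf x₀ R x)).differentiableAt.comp x (dq x))
      ((qS.dd isOpen_univ _).da isOpen_univ (mem_univ x)), dd_comp (ddP _) (dq x), dd_dd_qf]
  have hqsum : ∀ x, ∑ i, dd (EuclideanSpace.single i 1) (qf x₀ R) x *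
      dd (EuclideanSpace.single i 1) (qf x₀ R) x = (32 / (5 * R ^ 2)) ^ 2 * ‖x - x₀‖ ^ 2 := by
    intro x
    rw [EuclideanSpace.norm_sq_eq, Finset.mul_sum]
    refine Finset.sum_congr rfl fun i _ => ?_
    rw [dd_qf, Real.norm_eq_abs, sq_abs]
    simp only [PiLp.sub_apply]
    ring
  have hqb : ∀ x ∈ ball x₀ (3 * R / 4), ∑ i, dd (EuclideanSpace.single i 1) (qf x₀ R) x *
      dd (EuclideanSpace.single i 1) (qf x₀ R) x ≤ 25 / R ^ 2 := by
    intro x hx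
    rw [hqsum]
    have h1 : ‖x - x₀‖ ≤ 3 * R / 4 := by
      rw [mem_ball, dist_eq_norm] at hx; exact hx.le
    calc _ ≤ (32 / (5 * R ^ 2)) ^ 2 * (3 * R / 4) ^ 2 := by gcongr
      _ = (576 / 25) / R ^ 2 := by field_simp; norm_num
      _ ≤ _ := by gcongr; norm_num
  have hqI : ∀ x ∈ ball x₀ (3 * R / 4), qf x₀ R x ∈ Icc (0 : ℝ) 2 := by
    intro x hx
    have h1 : ‖x - x₀‖ ≤ 3 * R / 4 := by
      rw [mem_ball, dist_eq_norm] at hx; exact hx.le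
    have h2 : ‖x - x₀‖ ^ 2 / R ^ 2 ≤ 9 / 16 := by
      rw [div_le_iff₀ (by positivity)]
      calc ‖x - x₀‖ ^ 2 ≤ (3 * R / 4) ^ 2 := by gcongr
        _ = _ := by ring
    have h3 : 0 ≤ ‖x - x₀‖ ^ 2 / R ^ 2 := by positivity
    unfold qf
    rw [mul_div_assoc]
    constructor <;> linarith
  have hinv : 1 / R ^ 2 ≤ 1 / R := by
    apply one_div_le_one_div_of_le hR0; nlinarith
  refine ⟨fun x => P (qf x₀ R x), hP.comp hq, fun x => P0 _, fun x => P1 _, ?_, ?_, ?_, ?_⟩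
  · intro x hx
    have h := Ppos _ hx
    unfold qf at h
    rw [mem_ball, dist_eq_norm]
    have h2 : ‖x - x₀‖ ^ 2 / R ^ 2 < 9 / 16 := by
      rw [mul_div_assoc] at h; linarith
    rw [div_lt_iff₀ (by positivity)] at h2
    exact lt_of_pow_lt_pow_left₀ 2 (by positivity) (by linarith)
  · intro x hx
    apply Pone
    rw [mem_ball, dist_eq_norm] at hx
    have h2 : ‖x - x₀‖ ^ 2 / R ^ 2 ≤ 4 / 16 := by
      rw [div_le_iff₀ (by positivity)]
      calc ‖x - x₀‖ ^ 2 ≤ (R / 2) ^ 2 := by gcongr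
        _ = _ := by ring
    unfold qf
    rw [mul_div_assoc]
    linarith
  · intro x hx
    simp only [dη]
    have : ∑ i, deriv P (qf x₀ R x) * dd (EuclideanSpace.single i 1) (qf x₀ R) x *
      (deriv P (qf x₀ R x) * dd (EuclideanSpace.single i 1) (qf x₀ R) x) =
      deriv P (qf x₀ R x) ^ 2 * ∑ i, dd (EuclideanSpace.single i 1) (qf x₀ R) x *
      dd (EuclideanSpace.single i 1) (qf x₀ R) x := by
      rw [Finset.mul_sum]; exact Finset.sum_congr rfl fun i _ => by ring
    rw [this]
    have hPnn := P0 (qf x₀ R x)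
    calc _ ≤ (M * P (qf x₀ R x)) * (25 / R ^ 2) := by
          gcongr
          · exact Finset.sum_nonneg fun i _ => mul_self_nonneg _
          · exact dPsq _ (hqI x hx)
          · exact hqb x hx
      _ = 25 * (M * P (qf x₀ R x)) * (1 / R ^ 2) := by ring
      _ ≤ 32 * (M * P (qf x₀ R x)) * ((1 + |alphaC f x₀|) / R) := by
          gcongr
          · norm_num
          · linarith
          · nlinarith
      _ = _ := by ring
  · intro x hx
    simp only [dη, ddη]
    rw [Finset.sum_add_distrib]
    have e1 : ∑ i, deriv (deriv P) (qf x₀ R x) * dd (EuclideanSpace.single i 1) (qf x₀ R) x *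
        dd (EuclideanSpace.single i 1) (qf x₀ R) x = deriv (deriv P) (qf x₀ R x) *
        ∑ i, dd (EuclideanSpace.single i 1) (qf x₀ R) x *
          dd (EuclideanSpace.single i 1) (qf x₀ R) x := by
      rw [Finset.mul_sum]; exact Finset.sum_congr rfl fun i _ => by ring
    have e2 : ∑ i, dd (EuclideanSpace.single i 1) f x * (deriv P (qf x₀ R x) *
        dd (EuclideanSpace.single i 1) (qf x₀ R) x) =
        deriv P (qf x₀ R x) * (-(32 / (5 * R ^ 2))) * dd (x - x₀) f x := by
      rw [dd_expand f x (x - x₀), Finset.mul_sum]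
      refine Finset.sum_congr rfl fun i _ => ?_
      rw [dd_qf]
      simp only [PiLp.sub_apply]
      ring
    rw [e1, e2]
    simp only [Finset.sum_const, Finset.card_univ, Fintype.card_fin, nsmul_eq_mul]
    set q := qf x₀ R x with hqdef
    set Sq := ∑ i, dd (EuclideanSpace.single i 1) (qf x₀ R) x *
          dd (EuclideanSpace.single i 1) (qf x₀ R) x with hSq
    have hSq0 : 0 ≤ Sq := Finset.sum_nonneg fun i _ => mul_self_nonneg _
    have hSqb : Sq ≤ 25 / R ^ 2 := hqb x hx
    have k1 : -(deriv (deriv P) q * Sq) ≤ M * (25 / R ^ 2) := by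
      have := ddPM q (hqI x hx)
      calc -(deriv (deriv P) q * Sq) ≤ |deriv (deriv P) q| * Sq := by
            nlinarith [neg_abs_le (deriv (deriv P) q)]
        _ ≤ _ := by gcongr
    have k2 : deriv P q * ((32 / (5 * R ^ 2)) * (n - dd (x - x₀) f x)) ≤
        M * ((32 / (5 * R ^ 2)) * (1 + R * |alphaC f x₀| + n * K * R ^ 2)) := by
      by_cases hr : 1 ≤ ‖x - x₀‖
      · have hxR : x ∈ ball x₀ R := ball_subset_ball (by linarith) hx
        have hc := alpha_compare hn hf hK hH hxR hr
        have h1 := dPM q (hqI x hx)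
        have h2 := dP0 q
        calc _ ≤ deriv P q * ((32 / (5 * R ^ 2)) * (1 + R * |alphaC f x₀| + n * K * R ^ 2)) := by
              gcongr
          _ ≤ _ := by gcongr
      · push Not at hr
        have : 1 ≤ q := by
          have h2 : ‖x - x₀‖ ^ 2 / R ^ 2 ≤ 4 / 16 := by
            rw [div_le_iff₀ (by positivity)]
            calc ‖x - x₀‖ ^ 2 ≤ (R / 2) ^ 2 := by gcongr; linarith
              _ = _ := by ring
          rw [hqdef]
          unfold qf
          rw [mul_div_assoc]
          linarith
        rw [dPz q this, zero_mul]
        positivity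
    have k3 : M * (25 / R ^ 2) + M * ((32 / (5 * R ^ 2)) * (1 + R * |alphaC f x₀| + n * K * R ^ 2))
        = M * ((157 / 5) * (1 / R ^ 2) + (32 / 5) * (|alphaC f x₀| / R) + (32 / 5) * (n * K)) := by
      field_simp
      ring
    have k4 : M * ((157 / 5) * (1 / R ^ 2) + (32 / 5) * (|alphaC f x₀| / R) + (32 / 5) * (n * K)) ≤
        M * (32 * (1 / R) + 32 * (|alphaC f x₀| / R) + 32 * (n * K)) := by
      gcongr <;> norm_num
    have k5 : M * (32 * (1 / R) + 32 * (|alphaC f x₀| / R) + 32 * (n * K)) =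
        32 * M * ((1 + |alphaC f x₀|) / R + n * K) := by ring
    linarith

end cutoff
section equation

variable {n : ℕ}

theorem slice_fderiv {g : EuclideanSpace ℝ (Fin n) × ℝ → ℝ} {x : EuclideanSpace ℝ (Fin n)} {t : ℝ}
    (hg : DifferentiableAt ℝ g (x, t)) (v : EuclideanSpace ℝ (Fin n)) :
    fderiv ℝ (fun y => g (y, t)) x v = dd (v, 0) g (x, t) := by
  have h1 : HasFDerivAt (fun y : EuclideanSpace ℝ (Fin n) => (y, t))
    (ContinuousLinearMap.inl ℝ (EuclideanSpace ℝ (Fin n)) ℝ) x := hasFDerivAt_prodMk_left x t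
  have h2 : HasFDerivAt (fun y => g (y, t)) _ x := hg.hasFDerivAt.comp x h1
  rw [h2.fderiv]
  simp [dd]

theorem slice_deriv {g : EuclideanSpace ℝ (Fin n) × ℝ → ℝ} {x : EuclideanSpace ℝ (Fin n)} {t : ℝ}
    (hg : DifferentiableAt ℝ g (x, t)) :
    deriv (fun s => g (x, s)) t = dd (tm n) g (x, t) := by
  have h1 : HasFDerivAt (fun s : ℝ => (x, s))
    (ContinuousLinearMap.inr ℝ (EuclideanSpace ℝ (Fin n)) ℝ) t := hasFDerivAt_prodMk_right x t
  have h2 : HasFDerivAt (fun s => g (x, s)) _ t := hg.hasFDerivAt.comp t h1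
  rw [← fderiv_apply_one_eq_deriv, h2.fderiv]
  simp [dd, tm]

theorem slice_eLap {O : Set (EuclideanSpace ℝ (Fin n) × ℝ)} (hO : IsOpen O)
    {g : EuclideanSpace ℝ (Fin n) × ℝ → ℝ} (hg : Sm O g) {x : EuclideanSpace ℝ (Fin n)} {t : ℝ}
    (hp : (x, t) ∈ O) :
    eLap (fun y => g (y, t)) x = ∑ i, dd (sp n i) (dd (sp n i) g) (x, t) := by
  unfold eLap
  refine Finset.sum_congr rfl fun i _ => ?_
  have hev : (fun y => fderiv ℝ (fun y => g (y, t)) y (EuclideanSpace.single i 1)) =ᶠ[nhds x]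
      fun y => dd (sp n i) g (y, t) := by
    have hc : Continuous (fun y : EuclideanSpace ℝ (Fin n) => (y, t)) := by fun_prop
    filter_upwards [hc.continuousAt.preimage_mem_nhds (hO.mem_nhds hp)] with y hy
    exact slice_fderiv (hg.da hO hy) _
  rw [hev.fderiv_eq]
  exact slice_fderiv ((hg.dd hO (sp n i)).da hO hp) _

theorem hess_expand {f : EuclideanSpace ℝ (Fin n) → ℝ} (hf : ContDiff ℝ (⊤ : ℕ∞) f)
    (x v : EuclideanSpace ℝ (Fin n)) :
    hessQF f x v = ∑ i, ∑ j, dd (EuclideanSpace.single i 1) (dd (EuclideanSpace.single j 1) f) x *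
      v i * v j := by
  have fS : Sm univ f := hf.contDiffOn
  have fd : ∀ V y, DifferentiableAt ℝ (dd V f) y := fun V y =>
    (fS.dd isOpen_univ V).da isOpen_univ (mem_univ y)
  change dd v (dd v f) x = _
  rw [dd_expand (dd v f) x v]
  refine Finset.sum_congr rfl fun i _ => ?_
  have : dd v f = fun y => ∑ j, v j * dd (EuclideanSpace.single j 1) f y :=
    funext fun y => dd_expand f y v
  rw [this, dd_sum _ (fun j _ => (fd _ x).const_mul _), Finset.mul_sum]
  refine Finset.sum_congr rfl fun j _ => ?_
  rw [dd_mul (differentiableAt_const _) (fd _ x), dd_const]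
  ring

/-- the profile function relating `u` and `φ`. -/
theorem lp_deriv {D y : ℝ} (hy : 0 < y) (hm : 0 < 1 + Real.log D - Real.log y) :
    HasDerivAt (fun y => Real.log (1 + Real.log D - Real.log y))
      (-(1 / (y * (1 + Real.log D - Real.log y)))) y := by
  have h1 := ((Real.hasDerivAt_log hy.ne').const_sub (1 + Real.log D)).log hm.ne'
  convert h1 using 1
  field_simp

theorem lp_deriv2 {D y : ℝ} (hy : 0 < y) (hm : 0 < 1 + Real.log D - Real.log y) :
    HasDerivAt (fun y => -(1 / (y * (1 + Real.log D - Real.log y))))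
      ((Real.log D - Real.log y) / (y * (1 + Real.log D - Real.log y)) ^ 2) y := by
  have h1 := (Real.hasDerivAt_log hy.ne').const_sub (1 + Real.log D)
  have h2 : HasDerivAt (fun y => y * (1 + Real.log D - Real.log y)) _ y := (hasDerivAt_id y).mul h1
  have h3 := (h2.fun_inv (by positivity)).neg
  have h4 : (fun y => -(1 / (y * (1 + Real.log D - Real.log y)))) =
    (-fun y => (y * (1 + Real.log D - Real.log y))⁻¹) := by
    ext z; simp
  rw [h4]
  refine h3.congr_deriv ?_
  have e : y * -y⁻¹ = -1 := by field_simp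
  simp only [id_eq, e]
  ring

theorem phi_eq_algebra {ι : Type*} [Fintype ι] (Uj Ujj Fj : ι → ℝ) (y lD ly m a P₁ P₂ Ut : ℝ)
    (hy : 0 < y) (hm : m = 1 + lD - ly) (hm0 : 0 < m) (hP₁ : P₁ = -(1 / (y * m)))
    (hP₂ : P₂ = (lD - ly) / (y * m) ^ 2)
    (hU : Ut = ∑ j, Ujj j - ∑ j, Fj j * Uj j + a * y * ly) :
    P₁ * Ut = ∑ j, (P₂ * Uj j * Uj j + P₁ * Ujj j) - ∑ j, Fj j * (P₁ * Uj j)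
      + (1 - m) * (∑ j, (P₁ * Uj j) * (P₁ * Uj j)) + (a - a * (1 + lD) * m⁻¹) := by
  have hP : P₂ = (m - 1) * P₁ ^ 2 := by
    have h3 : lD - ly = m - 1 := by rw [hm]; ring
    rw [hP₂, hP₁, h3]
    field_simp
  have e1 : ∑ j, (P₂ * Uj j * Uj j + P₁ * Ujj j) = P₂ * (∑ j, Uj j * Uj j) + P₁ * ∑ j, Ujj j := by
    rw [Finset.mul_sum, Finset.mul_sum, ← Finset.sum_add_distrib]
    exact Finset.sum_congr rfl fun j _ => by ring
  have e2 : ∑ j, Fj j * (P₁ * Uj j) = P₁ * ∑ j, Fj j * Uj j := by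
    rw [Finset.mul_sum]; exact Finset.sum_congr rfl fun j _ => by ring
  have e3 : ∑ j, (P₁ * Uj j) * (P₁ * Uj j) = P₁ ^ 2 * ∑ j, Uj j * Uj j := by
    rw [Finset.mul_sum]; exact Finset.sum_congr rfl fun j _ => by ring
  rw [e1, e2, e3, hU, hP]
  have e4 : P₁ * (a * y * ly) = a - a * (1 + lD) * m⁻¹ := by
    rw [hP₁]
    field_simp
    rw [hm]; ring
  linear_combination e4

end equation

section main

variable {n : ℕ}

theorem interior_estimate {M : ℝ} (hM : 0 ≤ M) (hn : 1 ≤ n)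
    (f : EuclideanSpace ℝ (Fin n) → ℝ) (x₀ : EuclideanSpace ℝ (Fin n))
    (R K t₀ T a D : ℝ) (u : EuclideanSpace ℝ (Fin n) → ℝ → ℝ)
    (hf : ContDiff ℝ (⊤ : ℕ∞) f) (hR : 2 ≤ R) (hK : 0 ≤ K) (ha : 0 ≤ a)
    (hH : ∀ x ∈ ball x₀ R, ∀ v : EuclideanSpace ℝ (Fin n),
          hessQF f x v ≥ -((n : ℝ) - 1) * K * ‖v‖ ^ 2)
    (hu : ContDiffOn ℝ (⊤ : ℕ∞) (fun p : EuclideanSpace ℝ (Fin n) × ℝ => u p.1 p.2)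
          (ball x₀ R ×ˢ Icc (t₀ - T) t₀))
    (hpos : ∀ x ∈ ball x₀ R, ∀ t ∈ Icc (t₀ - T) t₀, 0 < u x t ∧ u x t ≤ D)
    (heq : ∀ x ∈ ball x₀ R, ∀ t ∈ Icc (t₀ - T) t₀,
          deriv (fun s => u x s) t
            = fLap f (fun y => u y t) x + a * u x t * Real.log (u x t))
    {η : EuclideanSpace ℝ (Fin n) → ℝ} (hη : ContDiff ℝ (⊤ : ℕ∞) η) (hη0 : ∀ x, 0 ≤ η x)
    (hη1 : ∀ x, η x ≤ 1)
    (hηs : ∀ x, 0 < η x → x ∈ ball x₀ (3 * R / 4)) (hηe : ∀ x ∈ ball x₀ (R / 2), η x = 1)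
    (hηg : ∀ x ∈ ball x₀ (3 * R / 4), ∑ i, dd (EuclideanSpace.single i 1) η x *
        dd (EuclideanSpace.single i 1) η x ≤ M * ((1 + |alphaC f x₀|) / R) * η x)
    (hηL : ∀ x ∈ ball x₀ (3 * R / 4),
        -(∑ i, dd (EuclideanSpace.single i 1) (dd (EuclideanSpace.single i 1) η) x
       - ∑ i, dd (EuclideanSpace.single i 1) f x * dd (EuclideanSpace.single i 1) η x) ≤
        M * ((1 + |alphaC f x₀|) / R + n * K))
    (x : EuclideanSpace ℝ (Fin n)) (hx : x ∈ ball x₀ (R / 2)) (t : ℝ) (ht : t ∈ Ioo (t₀ - T) t₀) :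
    (‖gradient (fun y => u y t) x‖ / u x t / (1 + Real.log (D / u x t))) ^ 2 ≤
      3 * (M * ((1 + |alphaC f x₀|) / R)) + 2 * ((n - 1) * K + a * (max |Real.log D| 1 + 1))
        + M * ((1 + |alphaC f x₀|) / R + n * K) + 1 / (t - t₀ + T) := by
  have hn' : (1 : ℝ) ≤ n := by exact_mod_cast hn
  set O : Set (EuclideanSpace ℝ (Fin n) × ℝ) := ball x₀ R ×ˢ Ioo (t₀ - T) t₀ with hOdef
  have hO : IsOpen O := isOpen_ball.prod isOpen_Ioo
  have hmem : ∀ q ∈ O, q.1 ∈ ball x₀ R ∧ q.2 ∈ Icc (t₀ - T) t₀ := fun q hq =>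
    ⟨hq.1, Ioo_subset_Icc_self hq.2⟩
  set U : EuclideanSpace ℝ (Fin n) × ℝ → ℝ := fun p => u p.1 p.2 with hUdef
  have hU : Sm O U := hu.mono (prod_mono_right Ioo_subset_Icc_self)
  have Upos : ∀ q ∈ O, 0 < U q := fun q hq => (hpos _ (hmem q hq).1 _ (hmem q hq).2).1
  have UD : ∀ q ∈ O, U q ≤ D := fun q hq => (hpos _ (hmem q hq).1 _ (hmem q hq).2).2
  have hm1 : ∀ q ∈ O, 1 ≤ 1 + Real.log D - Real.log (U q) := by
    intro q hq
    have := Real.log_le_log (Upos q hq) (UD q hq)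
    linarith
  have hm0 : ∀ q ∈ O, 0 < 1 + Real.log D - Real.log (U q) := fun q hq => by
    linarith [hm1 q hq]
  set φ : EuclideanSpace ℝ (Fin n) × ℝ → ℝ :=
    fun p => Real.log (1 + Real.log D - Real.log (U p)) with hφdef
  have hφ : Sm O φ := by
    have h1 : ContDiffOn ℝ (⊤ : ℕ∞) (fun p => Real.log (U p)) O :=
      ContDiffOn.log hU fun q hq => (Upos q hq).ne'
    exact ContDiffOn.log (contDiffOn_const.sub h1) fun q hq => (hm0 q hq).ne'
  have hφ0 : ∀ q ∈ O, 0 ≤ φ q := fun q hq => Real.log_nonneg (hm1 q hq)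
  have hexp : ∀ q ∈ O, Real.exp (φ q) = 1 + Real.log D - Real.log (U q) := fun q hq =>
    Real.exp_log (hm0 q hq)
  set F : EuclideanSpace ℝ (Fin n) × ℝ → ℝ := fun p => f p.1 with hFdef
  have hF : Sm O F := (hf.comp contDiff_fst).contDiffOn
  have fS : Sm univ f := hf.contDiffOn
  have fd : ∀ V y, DifferentiableAt ℝ (dd V f) y := fun V y =>
    (fS.dd isOpen_univ V).da isOpen_univ (mem_univ y)
  have F1 : ∀ i q, dd (sp n i) F q = dd (EuclideanSpace.single i 1) f q.1 := fun i q =>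
    dd_fst _ _ _ (hf.differentiable (by simp) _)
  have F2 : ∀ i j q, dd (sp n i) (dd (sp n j) F) q =
      dd (EuclideanSpace.single i 1) (dd (EuclideanSpace.single j 1) f) q.1 := by
    intro i j q
    have : dd (sp n j) F = fun q => dd (EuclideanSpace.single j 1) f q.1 := funext fun q => F1 j q
    rw [this]
    exact dd_fst _ _ _ (fd _ _)
  -- the equation for U
  have Ueq : ∀ q ∈ O, dd (tm n) U q = ∑ j, dd (sp n j) (dd (sp n j) U) q
      - ∑ j, dd (sp n j) F q * dd (sp n j) U q + a * U q * Real.log (U q) := by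
    rintro ⟨y, s⟩ hq
    have h := heq y (hmem _ hq).1 s (hmem _ hq).2
    have h1 := slice_deriv (hU.da hO hq)
    have h2 := slice_eLap hO hU hq
    simp only [hUdef] at h1 h2 ⊢
    rw [← h1, ← h2, h, fLap, gradient_inner_sum]
    have hs : ∑ j, dd (EuclideanSpace.single j 1) f y *
        dd (EuclideanSpace.single j 1) (fun y => u y s) y =
        ∑ j, dd (sp n j) F (y, s) * dd (sp n j) U (y, s) := by
      refine Finset.sum_congr rfl fun j _ => ?_
      rw [F1]
      congr 1
      exact slice_fderiv (hU.da hO hq) _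
    rw [hs]
  have φ1 : ∀ V, ∀ q ∈ O, dd V φ q =
      -(1 / (U q * (1 + Real.log D - Real.log (U q)))) * dd V U q := fun V q hq =>
    dd_comp (lp_deriv (Upos q hq) (hm0 q hq)) (hU.da hO hq) V
  have φ2 : ∀ V, ∀ q ∈ O, dd V (dd V φ) q =
      (Real.log D - Real.log (U q)) / (U q * (1 + Real.log D - Real.log (U q))) ^ 2 *
        dd V U q * dd V U q +
      -(1 / (U q * (1 + Real.log D - Real.log (U q)))) * dd V (dd V U) q := by
    intro V q hq
    rw [dd_congr hO hq (φ1 V)]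
    have hl := lp_deriv2 (Upos q hq) (hm0 q hq)
    rw [dd_mul (g := fun q => -(1 / (U q * (1 + Real.log D - Real.log (U q)))))
      (hl.differentiableAt.comp q (hU.da hO hq)) ((hU.dd hO V).da hO hq),
      dd_comp hl (hU.da hO hq)]
  have φeq : ∀ q ∈ O, dd (tm n) φ q = ∑ j, dd (sp n j) (dd (sp n j) φ) q
      - ∑ j, dd (sp n j) F q * dd (sp n j) φ q
      + (1 - Real.exp (φ q)) * gsq (sp n) φ q
      + (a - a * (1 + Real.log D) * Real.exp (-φ q)) := by
    intro q hq
    unfold gsq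
    simp only [φ2 _ q hq, φ1 _ q hq]
    rw [Real.exp_neg, hexp q hq]
    exact phi_eq_algebra _ _ _ (U q) (Real.log D) (Real.log (U q)) _ a _ _ _ (Upos q hq) rfl
      (hm0 q hq) rfl rfl (Ueq q hq)
  set κ := max |Real.log D| 1 with hκ
  have hκ1 : 1 ≤ κ := le_max_right _ _
  have hκD : Real.log D ≤ κ := (le_abs_self _).trans (le_max_left _ _)
  have hboch : ∀ p ∈ O, 2 * Real.exp (φ p) * gsq (sp n) φ p ^ 2
      + 2 * (Real.exp (φ p) - 1) * (∑ j, dd (sp n j) φ p * dd (sp n j) (gsq (sp n) φ) p)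
      - 2 * ((n - 1) * K + a * (κ + 1)) * gsq (sp n) φ p ≤
      ∑ j, dd (sp n j) (dd (sp n j) (gsq (sp n) φ)) p
      - ∑ j, dd (sp n j) F p * dd (sp n j) (gsq (sp n) φ) p - dd (tm n) (gsq (sp n) φ) p := by
    intro p hp
    have hb := bochner hO hF hφ (sp n) (tm n) a (1 + Real.log D) ((n - 1) * K) hp φeq (by
      have h := hH p.1 (hmem p hp).1 (WithLp.toLp 2 fun i => dd (sp n i) φ p)
      rw [hess_expand hf, EuclideanSpace.norm_sq_eq] at h
      simp only [F2]
      have e : gsq (sp n) φ p = ∑ i, ‖dd (sp n i) φ p‖ ^ 2 :=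
        Finset.sum_congr rfl fun i _ => by rw [Real.norm_eq_abs, sq_abs]; ring
      rw [e]
      have h' := h.le
      simpa only [neg_mul] using h')
    have hw0 : 0 ≤ gsq (sp n) φ p := Finset.sum_nonneg fun i _ => mul_self_nonneg _
    have hL : a * (1 + Real.log D) * Real.exp (-φ p) ≤ a * (κ + 1) := by
      have h1 : Real.exp (-φ p) ≤ 1 := Real.exp_le_one_iff.2 (by linarith [hφ0 p hp])
      have h2 := Real.exp_pos (-φ p)
      calc a * (1 + Real.log D) * Real.exp (-φ p) ≤ a * (κ + 1) * Real.exp (-φ p) := by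
            have h3 : 1 + Real.log D ≤ κ + 1 := by linarith
            exact mul_le_mul_of_nonneg_right (mul_le_mul_of_nonneg_left h3 ha) h2.le
        _ ≤ a * (κ + 1) * 1 := by gcongr
        _ = _ := by ring
    have := mul_le_mul_of_nonneg_right hL hw0
    linarith
  have hxR : x ∈ ball x₀ R := ball_subset_ball (by linarith) hx
  have hxt : (x, t) ∈ O := ⟨hxR, ht⟩
  have hα0 := abs_nonneg (alphaC f x₀)
  have hα1 : 0 ≤ (1 + |alphaC f x₀|) / R := by positivity
  have hest : ∀ s₀ ∈ Ioo (t₀ - T) t, gsq (sp n) φ (x, t) ≤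
      3 * (M * ((1 + |alphaC f x₀|) / R)) + 2 * ((n - 1) * K + a * (κ + 1))
        + M * ((1 + |alphaC f x₀|) / R + n * K) + 1 / (t - s₀) := by
    intro s₀ hs
    have := max_principle hO hφ hη x₀ (3 * R / 4) s₀ t hs.2
      (by
        rintro ⟨y, s⟩ ⟨hy, hs'⟩
        refine ⟨closedBall_subset_ball (by linarith) hy, ?_, ?_⟩
        · exact hs.1.trans_le hs'.1
        · exact hs'.2.trans_lt ht.2)
      hη0 hη1 hηs ((n - 1) * K + a * (κ + 1)) (M * ((1 + |alphaC f x₀|) / R))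
      (M * ((1 + |alphaC f x₀|) / R + n * K))
      (by
        have : (0 : ℝ) ≤ n - 1 := by linarith
        positivity) (by positivity) (by positivity) hφ0 hboch hηg
      (fun p _ hp => by simp only [F1]; exact hηL p.1 hp) x
      (ball_subset_closedBall (ball_subset_ball (by linarith) hx))
    rwa [hηe x hx, one_mul] at this
  have hlim : gsq (sp n) φ (x, t) ≤
      3 * (M * ((1 + |alphaC f x₀|) / R)) + 2 * ((n - 1) * K + a * (κ + 1))
        + M * ((1 + |alphaC f x₀|) / R + n * K) + 1 / (t - t₀ + T) := by
    have hne : t - (t₀ - T) ≠ 0 := by linarith [ht.1]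
    have hT : Filter.Tendsto (fun s₀ => 3 * (M * ((1 + |alphaC f x₀|) / R))
        + 2 * ((n - 1) * K + a * (κ + 1))
        + M * ((1 + |alphaC f x₀|) / R + n * K) + 1 / (t - s₀)) (nhdsWithin (t₀ - T) (Ioi (t₀ - T)))
        (nhds (3 * (M * ((1 + |alphaC f x₀|) / R)) + 2 * ((n - 1) * K + a * (κ + 1))
        + M * ((1 + |alphaC f x₀|) / R + n * K) + 1 / (t - (t₀ - T)))) := by
      apply Filter.Tendsto.mono_left _ nhdsWithin_le_nhds
      have : ContinuousAt (fun s₀ => 1 / (t - s₀)) (t₀ - T) := by fun_prop (disch := assumption)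
      exact this.tendsto.const_add _
    have := ge_of_tendsto hT (by
      filter_upwards [Ioo_mem_nhdsGT ht.1] with s hs using hest s hs)
    have e : t - (t₀ - T) = t - t₀ + T := by ring
    rw [e] at this
    exact this
  refine le_trans (le_of_eq ?_) hlim
  unfold gsq
  simp only [φ1 _ _ hxt]
  have hgr : ‖gradient (fun y => u y t) x‖ ^ 2 = ∑ i, dd (sp n i) U (x, t) * dd (sp n i) U (x, t) := by
    rw [← real_inner_self_eq_norm_sq, gradient_inner_sum]
    refine Finset.sum_congr rfl fun i _ => ?_
    have : dd (EuclideanSpace.single i 1) (fun y => u y t) x = dd (sp n i) U (x, t) :=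
      slice_fderiv (hU.da hO hxt) _
    rw [this]
  have hlog : 1 + Real.log (D / u x t) = 1 + Real.log D - Real.log (U (x, t)) := by
    have h0 := Upos _ hxt
    have h1 := UD _ hxt
    have : 0 < D := by linarith
    rw [Real.log_div this.ne' h0.ne']
    ring
  rw [hlog, div_pow, div_pow, hgr]
  have e : ∀ c : ℝ, ∑ i, c * dd (sp n i) U (x, t) * (c * dd (sp n i) U (x, t)) =
      c ^ 2 * ∑ i, dd (sp n i) U (x, t) * dd (sp n i) U (x, t) := by
    intro c
    rw [Finset.mul_sum]; exact Finset.sum_congr rfl fun i _ => by ring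
  rw [e]
  have : u x t = U (x, t) := rfl
  rw [this]
  have h0 := Upos _ hxt
  have h1 := hm0 _ hxt
  field_simp

/-- Continuity in time (up to the boundary) of the spatial gradient. -/
theorem gradient_continuous {x₀ : EuclideanSpace ℝ (Fin n)} {R t₁ t₂ : ℝ} (ht : t₁ < t₂)
    {u : EuclideanSpace ℝ (Fin n) → ℝ → ℝ}
    (hu : ContDiffOn ℝ (⊤ : ℕ∞) (fun p : EuclideanSpace ℝ (Fin n) × ℝ => u p.1 p.2)
          (ball x₀ R ×ˢ Icc t₁ t₂)) {x : EuclideanSpace ℝ (Fin n)} (hx : x ∈ ball x₀ R) :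
    ContinuousOn (fun t => gradient (fun y => u y t) x) (Icc t₁ t₂) := by
  set Q : Set (EuclideanSpace ℝ (Fin n) × ℝ) := ball x₀ R ×ˢ Icc t₁ t₂ with hQ
  have hud : UniqueDiffOn ℝ Q := isOpen_ball.uniqueDiffOn.prod (uniqueDiffOn_Icc ht)
  have hc : ContinuousOn (fderivWithin ℝ (fun p : EuclideanSpace ℝ (Fin n) × ℝ => u p.1 p.2) Q) Q :=
    hu.continuousOn_fderivWithin hud (by simp)
  have hs : ∀ t ∈ Icc t₁ t₂, fderiv ℝ (fun y => u y t) x =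
      (fderivWithin ℝ (fun p : EuclideanSpace ℝ (Fin n) × ℝ => u p.1 p.2) Q (x, t)).comp
        (ContinuousLinearMap.inl ℝ (EuclideanSpace ℝ (Fin n)) ℝ) := by
    intro t htt
    have hd := (hu.differentiableOn (by simp) (x, t) ⟨hx, htt⟩).hasFDerivWithinAt
    have h1 : HasFDerivWithinAt (fun y : EuclideanSpace ℝ (Fin n) => (y, t))
      (ContinuousLinearMap.inl ℝ (EuclideanSpace ℝ (Fin n)) ℝ) (ball x₀ R) x :=
      (hasFDerivAt_prodMk_left x t).hasFDerivWithinAt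
    have h2 := hd.comp x h1 (show MapsTo (fun y : EuclideanSpace ℝ (Fin n) => (y, t))
      (ball x₀ R) Q from fun y hy => ⟨hy, htt⟩)
    exact (h2.hasFDerivAt (isOpen_ball.mem_nhds hx)).fderiv
  have hcf : ContinuousOn (fun t => fderiv ℝ (fun y => u y t) x) (Icc t₁ t₂) := by
    refine ContinuousOn.congr ?_ hs
    refine ContinuousOn.clm_comp ?_ continuousOn_const
    exact hc.comp (by fun_prop) (fun t htt => ⟨hx, htt⟩)
  exact (InnerProductSpace.toDual ℝ _).symm.continuous.comp_continuousOn hcf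

end main

/-- Souplet-Zhang-type gradient estimate for the nonlinear `f`-heat equation, case `a ≥ 0`
(Euclidean case of Theorem 1.4(i)). -/
theorem souplet_zhang_gradient_estimate_nonneg (n : ℕ) (hn : 1 ≤ n) :
    ∃ c : ℝ, 0 < c ∧
      ∀ (f : EuclideanSpace ℝ (Fin n) → ℝ) (x₀ : EuclideanSpace ℝ (Fin n))
        (R K t₀ T a D : ℝ) (u : EuclideanSpace ℝ (Fin n) → ℝ → ℝ),
        ContDiff ℝ (⊤ : ℕ∞) f →
        2 ≤ R → 0 ≤ K → 0 < T → 0 ≤ a → 0 < D →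
        (∀ x ∈ ball x₀ R, ∀ v : EuclideanSpace ℝ (Fin n),
          hessQF f x v ≥ -((n : ℝ) - 1) * K * ‖v‖ ^ 2) →
        ContDiffOn ℝ (⊤ : ℕ∞) (fun p : EuclideanSpace ℝ (Fin n) × ℝ => u p.1 p.2)
          (ball x₀ R ×ˢ Icc (t₀ - T) t₀) →
        (∀ x ∈ ball x₀ R, ∀ t ∈ Icc (t₀ - T) t₀, 0 < u x t ∧ u x t ≤ D) →
        (∀ x ∈ ball x₀ R, ∀ t ∈ Icc (t₀ - T) t₀,
          deriv (fun s => u x s) t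
            = fLap f (fun y => u y t) x + a * u x t * Real.log (u x t)) →
        ∀ x ∈ ball x₀ (R / 2), ∀ t ∈ Ioc (t₀ - T) t₀,
          ‖gradient (fun y => u y t) x‖ / u x t ≤
            c * (Real.sqrt ((1 + |alphaC f x₀|) / R) + 1 / Real.sqrt (t - t₀ + T)
                  + Real.sqrt K + Real.sqrt (a * (max |Real.log D| 1 + 1)))
              * (1 + Real.log (D / u x t)) := by
  obtain ⟨M, hM, hcut⟩ := cutoff_exists
  have hn' : (1 : ℝ) ≤ n := by exact_mod_cast hn
  set C : ℝ := 4 * M + M * n + 2 * n + 2 with hC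
  have hC0 : 0 < C := by positivity
  refine ⟨Real.sqrt C, Real.sqrt_pos.2 hC0, ?_⟩
  intro f x₀ R K t₀ T a D u hf hR hK hT ha hD hH hu hpos heq x hx
  obtain ⟨η, hη, hη0, hη1, hηs, hηe, hηg, hηL⟩ := hcut n hn f hf x₀ R K hK hR hH
  have hxR : x ∈ ball x₀ R := ball_subset_ball (by linarith) hx
  have hα0 := abs_nonneg (alphaC f x₀)
  set A : ℝ := (1 + |alphaC f x₀|) / R with hA
  have hA0 : 0 ≤ A := by positivity
  set B : ℝ := a * (max |Real.log D| 1 + 1) with hB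
  have hB0 : 0 ≤ B := by positivity
  have hinter : ∀ t ∈ Ioo (t₀ - T) t₀, ‖gradient (fun y => u y t) x‖ / u x t ≤
      Real.sqrt C * (Real.sqrt A + 1 / Real.sqrt (t - t₀ + T) + Real.sqrt K + Real.sqrt B)
        * (1 + Real.log (D / u x t)) := by
    intro t ht
    have hest := interior_estimate hM hn f x₀ R K t₀ T a D u hf hR hK ha hH hu hpos heq hη hη0 hη1
      hηs hηe hηg hηL x hx t ht
    obtain ⟨hu0, huD⟩ := hpos x hxR t (Ioo_subset_Icc_self ht)
    have hm : 1 ≤ 1 + Real.log (D / u x t) := by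
      have : 0 ≤ Real.log (D / u x t) := Real.log_nonneg ((one_le_div hu0).2 huD)
      linarith
    have hτ : 0 < t - t₀ + T := by linarith [ht.1]
    rw [← div_le_iff₀ (by linarith)]
    refine le_of_sq_le_sq ?_ (by positivity)
    refine hest.trans ?_
    rw [mul_pow, Real.sq_sqrt hC0.le]
    have hsum : A + 1 / (t - t₀ + T) + K + B ≤
        (Real.sqrt A + 1 / Real.sqrt (t - t₀ + T) + Real.sqrt K + Real.sqrt B) ^ 2 := by
      have h1 := Real.sq_sqrt hA0
      have h2 := Real.sq_sqrt hK
      have h3 := Real.sq_sqrt hB0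
      have h4 : (1 / Real.sqrt (t - t₀ + T)) ^ 2 = 1 / (t - t₀ + T) := by
        rw [div_pow, Real.sq_sqrt hτ.le, one_pow]
      have p1 := Real.sqrt_nonneg A
      have p2 := Real.sqrt_nonneg K
      have p3 := Real.sqrt_nonneg B
      have p4 : 0 ≤ 1 / Real.sqrt (t - t₀ + T) := by positivity
      generalize Real.sqrt A = s1 at *
      generalize Real.sqrt K = s2 at *
      generalize Real.sqrt B = s3 at *
      generalize 1 / Real.sqrt (t - t₀ + T) = s4 at *
      have q1 := mul_nonneg p1 p2
      have q2 := mul_nonneg p1 p3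
      have q3 := mul_nonneg p1 p4
      have q4 := mul_nonneg p2 p3
      have q5 := mul_nonneg p2 p4
      have q6 := mul_nonneg p3 p4
      nlinarith
    refine le_trans ?_ (mul_le_mul_of_nonneg_left hsum hC0.le)
    have hτi : 0 ≤ 1 / (t - t₀ + T) := by positivity
    generalize 1 / (t - t₀ + T) = θ at *
    have m1 : 0 ≤ M * n := by positivity
    have r1 : (4 * M) * A ≤ C * A := by gcongr; linarith
    have r2 : (M * n + 2 * n) * K ≤ C * K := by gcongr; linarith
    have r3 : 2 * B ≤ C * B := by gcongr; linarith
    have r4 : 1 * θ ≤ C * θ := by gcongr; linarith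
    nlinarith
  intro t ht
  rcases ht.2.lt_or_eq with hlt | rfl
  · exact hinter t ⟨ht.1, hlt⟩
  · have hlt : t - T < t := ht.1
    have hgc := gradient_continuous hlt hu hxR
    have hmem : t ∈ Icc (t - T) t := ⟨hlt.le, le_rfl⟩
    have huc : ContinuousOn (fun s => u x s) (Icc (t - T) t) :=
      hu.continuousOn.comp (f := fun s : ℝ => (x, s)) (by fun_prop) (fun s hs => ⟨hxR, hs⟩)
    have hu0 := (hpos x hxR t hmem).1
    have hle : nhdsWithin t (Ioo (t - T) t) ≤ nhdsWithin t (Icc (t - T) t) :=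
      nhdsWithin_mono _ Ioo_subset_Icc_self
    have c1 : ContinuousWithinAt (fun s => ‖gradient (fun y => u y s) x‖ / u x s)
        (Icc (t - T) t) t := (hgc t hmem).norm.div (huc t hmem) hu0.ne'
    have hT' : t - t + T ≠ 0 := by simp [hT.ne']
    have hT'' : Real.sqrt (t - t + T) ≠ 0 := by
      rw [sub_self, zero_add]; exact (Real.sqrt_pos.2 hT).ne'
    have c2 : ContinuousWithinAt (fun s => Real.sqrt C * (Real.sqrt A + 1 / Real.sqrt (s - t + T)
        + Real.sqrt K + Real.sqrt B) * (1 + Real.log (D / u x s))) (Icc (t - T) t) t := by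
      have d1 : ContinuousAt (fun s => 1 / Real.sqrt (s - t + T)) t := by
        fun_prop (disch := assumption)
      have d2 : ContinuousWithinAt (fun s => Real.log (D / u x s)) (Icc (t - T) t) t :=
        ContinuousWithinAt.log (continuousWithinAt_const.div (huc t hmem) hu0.ne')
          (div_pos hD hu0).ne'
      exact (continuousWithinAt_const.mul (((continuousWithinAt_const.add
        d1.continuousWithinAt).add continuousWithinAt_const).add continuousWithinAt_const)).mul
        (continuousWithinAt_const.add d2)
    have : (nhdsWithin t (Ioo (t - T) t)).NeBot := right_nhdsWithin_Ioo_neBot hlt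
    refine le_of_tendsto_of_tendsto (c1.mono_left hle) (c2.mono_left hle) ?_
    filter_upwards [self_mem_nhdsWithin] with s hs using hinter s hs
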